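/- arXiv:2310.14080 — 2 statements merged into one kernel-verified Lean document; each statement's English description precedes it below -/
import Mathlib

section
/- Let n ∈ {48, 56, 64}. Let C be an extremal Type II Z4-code of length n that is a free ZMod 4-module of rank k whose projection onto the first k coordinates is a bijection from C onto (ZMod 4)^k, and suppose the residue code C^(1) is an extremal Type II binary code of length n (so its minimum weight is 4⌊n/24⌋+4 = 12). Let 2u ∈ (ZMod 4)^n be an even vector with S₂(2u) ⊆ {k+1,…,n} and |S₂(2u)| even with |S₂(2u)| ≥ 6. If no codeword v of C satisfies any of the following three conditions: (1) S₂(v) ⊆ S₂(2u) ⊆ S₁(v)∪S₂(v)∪S₃(v) and |S₁(v)∪S₃(v)| = 16; (2) |S₂(2u) \ (S₁(v)∪S₂(v)∪S₃(v))| + |S₂(v) \ S₂(2u)| = 1 and |S₁(v)∪S₃(v)| = 12; (3) |S₂(2u) \ S₂(v)| + |S₂(v) \ S₂(2u)| ∈ {2,4} and |S₁(v)∪S₃(v)| = 0; then the doubled code C̃ = {v ∈ C : ⟨2u, v⟩ = 0} + span{2u} is an extremal Type II Z4-code of length n. -/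
open Finset

def z4Inner {n : ℕ} (x y : Fin n → ZMod 4) : ZMod 4 := ∑ i, x i * y i

def z4Dual {n : ℕ} (C : Set (Fin n → ZMod 4)) : Set (Fin n → ZMod 4) :=
  {x | ∀ c ∈ C, z4Inner x c = 0}

def IsSelfDualZ4 {n : ℕ} (C : Set (Fin n → ZMod 4)) : Prop := C = z4Dual C

def euclWt {n : ℕ} (x : Fin n → ZMod 4) : ℕ :=
  ∑ i, (if x i = 0 then 0 else if x i = 2 then 4 else 1)

def IsTypeIIZ4 {n : ℕ} (C : Set (Fin n → ZMod 4)) : Prop :=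
  IsSelfDualZ4 C ∧ ∀ c ∈ C, 8 ∣ euclWt c

def IsExtremalTypeIIZ4 (n : ℕ) (C : Set (Fin n → ZMod 4)) : Prop :=
  IsTypeIIZ4 C ∧ sInf (euclWt '' (C \ {0})) = 8 * (n / 24) + 8

def IsEvenVec {n : ℕ} (x : Fin n → ZMod 4) : Prop := ∀ i, x i = 0 ∨ x i = 2

def Sset {n : ℕ} (w : Fin n → ZMod 4) (a : ZMod 4) : Finset (Fin n) :=
  Finset.univ.filter (fun j => w j = a)

def doubled {n : ℕ} (C : Set (Fin n → ZMod 4)) (tu : Fin n → ZMod 4) :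
    Set (Fin n → ZMod 4) :=
  {w | ∃ v ∈ C, z4Inner tu v = 0 ∧ ∃ a : ZMod 4, w = v + a • tu}

def bInner {n : ℕ} (x y : Fin n → ZMod 2) : ZMod 2 := ∑ i, x i * y i

def bDual {n : ℕ} (D : Set (Fin n → ZMod 2)) : Set (Fin n → ZMod 2) :=
  {x | ∀ y ∈ D, bInner x y = 0}

def hWt {n : ℕ} (x : Fin n → ZMod 2) : ℕ := (Finset.univ.filter fun i => x i ≠ 0).card

def IsTypeIIBin {n : ℕ} (D : Set (Fin n → ZMod 2)) : Prop :=
  D = bDual D ∧ ∀ y ∈ D, 4 ∣ hWt y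

def IsExtremalTypeIIBin (n : ℕ) (D : Set (Fin n → ZMod 2)) : Prop :=
  IsTypeIIBin D ∧ sInf (hWt '' (D \ {0})) = 4 * (n / 24) + 4

def residueSet {n : ℕ} (C : Set (Fin n → ZMod 4)) : Set (Fin n → ZMod 2) :=
  {y | ∃ c ∈ C, y = fun i => ZMod.castHom (by norm_num : (2:ℕ) ∣ 4) (ZMod 2) (c i)}

def torsionSet {n : ℕ} (C : Set (Fin n → ZMod 4)) : Set (Fin n → ZMod 2) :=
  {c | (fun i => 2 * ((c i).val : ZMod 4)) ∈ C}

def rInner {n : ℕ} (x y : Fin n → ℝ) : ℝ := ∑ i, x i * y i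

def A4lattice {n : ℕ} (C : Set (Fin n → ZMod 4)) : Set (Fin n → ℝ) :=
  {x | ∃ z : Fin n → ℤ, (∀ i, 2 * x i = (z i : ℝ)) ∧ (fun i => (z i : ZMod 4)) ∈ C}

def dualLattice {n : ℕ} (L : Set (Fin n → ℝ)) : Set (Fin n → ℝ) :=
  {y | ∀ x ∈ L, ∃ m : ℤ, rInner x y = (m : ℝ)}

def IsIntegralLattice {n : ℕ} (L : Set (Fin n → ℝ)) : Prop :=
  ∀ x ∈ L, ∀ y ∈ L, ∃ m : ℤ, rInner x y = (m : ℝ)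

def IsEvenLattice {n : ℕ} (L : Set (Fin n → ℝ)) : Prop :=
  IsIntegralLattice L ∧ ∀ x ∈ L, ∃ m : ℤ, rInner x x = 2 * (m : ℝ)

def IsUnimodularLattice {n : ℕ} (L : Set (Fin n → ℝ)) : Prop :=
  IsIntegralLattice L ∧ L = dualLattice L

def MonomiallyEquiv {n : ℕ} (C D : Set (Fin n → ZMod 4)) : Prop :=
  ∃ (σ : Equiv.Perm (Fin n)) (ε : Fin n → ZMod 4), (∀ i, ε i = 1 ∨ ε i = 3) ∧
    D = (fun x => fun i => ε i * x (σ i)) '' C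

namespace DoublingAux

/-- positions of odd entries -/
def oddS {n : ℕ} (w : Fin n → ZMod 4) : Finset (Fin n) :=
  Finset.univ.filter (fun j => w j = 1 ∨ w j = 3)

lemma mem_oddS {n : ℕ} (w : Fin n → ZMod 4) (p : Fin n) :
    p ∈ oddS w ↔ (w p = 1 ∨ w p = 3) := by simp [oddS]

lemma mem_two {n : ℕ} (w : Fin n → ZMod 4) (p : Fin n) :
    p ∈ Sset w 2 ↔ w p = 2 := by simp [Sset]

lemma z4Inner_comm {n : ℕ} (x y : Fin n → ZMod 4) : z4Inner x y = z4Inner y x := by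
  simp [z4Inner, mul_comm]

lemma z4Inner_add_right {n : ℕ} (x y z : Fin n → ZMod 4) :
    z4Inner x (y + z) = z4Inner x y + z4Inner x z := by
  simp [z4Inner, mul_add, Finset.sum_add_distrib]

lemma z4Inner_add_left {n : ℕ} (x y z : Fin n → ZMod 4) :
    z4Inner (x + y) z = z4Inner x z + z4Inner y z := by
  simp [z4Inner, add_mul, Finset.sum_add_distrib]

lemma z4Inner_sub_left {n : ℕ} (x y z : Fin n → ZMod 4) :
    z4Inner (x - y) z = z4Inner x z - z4Inner y z := by
  simp [z4Inner, sub_mul, Finset.sum_sub_distrib]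

lemma z4Inner_smul_right {n : ℕ} (a : ZMod 4) (x y : Fin n → ZMod 4) :
    z4Inner x (a • y) = a * z4Inner x y := by
  simp only [z4Inner, Finset.mul_sum, Pi.smul_apply, smul_eq_mul]
  exact Finset.sum_congr rfl fun i _ => by ring

lemma z4Inner_smul_left {n : ℕ} (a : ZMod 4) (x y : Fin n → ZMod 4) :
    z4Inner (a • x) y = a * z4Inner x y := by
  rw [z4Inner_comm, z4Inner_smul_right, z4Inner_comm]

lemma z4Inner_zero_right {n : ℕ} (x : Fin n → ZMod 4) : z4Inner x 0 = 0 := by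
  simp [z4Inner]

lemma even_two_mul {n : ℕ} {y : Fin n → ZMod 4} (hy : IsEvenVec y) (w : Fin n → ZMod 4) :
    z4Inner y w = 0 ∨ z4Inner y w = 2 := by
  have h : 2 * z4Inner y w = 0 := by
    simp only [z4Inner, Finset.mul_sum]
    apply Finset.sum_eq_zero
    intro i _
    rcases hy i with h | h <;> rw [h]
    · simp
    · rw [← mul_assoc]
      have : (2 : ZMod 4) * 2 = 0 := by decide
      rw [this, zero_mul]
  revert h
  generalize z4Inner y w = a
  revert a
  decide

lemma adj {n : ℕ} (A : Submodule (ZMod 4) (Fin n → ZMod 4)) {y : Fin n → ZMod 4}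
    (hy : IsEvenVec y) (x : Fin n → ZMod 4)
    (hx : ∀ w ∈ A, z4Inner y w = 0 → z4Inner x w = 0) :
    (∀ w ∈ A, z4Inner x w = 0) ∨ (∀ w ∈ A, z4Inner (x - y) w = 0) := by
  by_cases h : ∀ w ∈ A, z4Inner x w = 0
  · exact Or.inl h
  right
  push Not at h
  obtain ⟨v, hv, hxv⟩ := h
  have hyv : z4Inner y v = 2 :=
    (even_two_mul hy v).resolve_left fun h0 => hxv (hx v hv h0)
  have h2 : z4Inner x ((2 : ZMod 4) • v) = 0 := by
    apply hx _ (A.smul_mem _ hv)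
    rw [z4Inner_smul_right, hyv]; decide
  rw [z4Inner_smul_right] at h2
  intro w hw
  rw [z4Inner_sub_left]
  rcases even_two_mul hy w with h0 | h0
  · rw [h0, hx w hw h0]; decide
  · have h3 : z4Inner x (w + v) = 0 := by
      apply hx _ (A.add_mem hw hv)
      rw [z4Inner_add_right, hyv, h0]; decide
    rw [z4Inner_add_right] at h3
    rw [h0]
    revert h2 h3 hxv
    generalize z4Inner x v = a
    generalize z4Inner x w = b
    revert a b
    decide

/-- the subcode of codewords even on `P` -/
def evenOn {n : ℕ} (K : Submodule (ZMod 4) (Fin n → ZMod 4)) (P : Finset (Fin n)) :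
    Submodule (ZMod 4) (Fin n → ZMod 4) where
  carrier := {w | w ∈ K ∧ ∀ p ∈ P, 2 * w p = 0}
  add_mem' := by
    rintro a b ⟨ha, ha'⟩ ⟨hb, hb'⟩
    refine ⟨K.add_mem ha hb, fun p hp => ?_⟩
    rw [Pi.add_apply, mul_add, ha' p hp, hb' p hp, add_zero]
  zero_mem' := ⟨K.zero_mem, fun p _ => by simp⟩
  smul_mem' := by
    rintro c a ⟨ha, ha'⟩
    refine ⟨K.smul_mem c ha, fun p hp => ?_⟩
    rw [Pi.smul_apply, smul_eq_mul, mul_left_comm, ha' p hp, mul_zero]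

lemma mem_evenOn {n : ℕ} (K : Submodule (ZMod 4) (Fin n → ZMod 4)) (P : Finset (Fin n))
    (w : Fin n → ZMod 4) : w ∈ evenOn K P ↔ w ∈ K ∧ ∀ p ∈ P, 2 * w p = 0 := Iff.rfl

lemma dual_evenOn {n : ℕ} (K : Submodule (ZMod 4) (Fin n → ZMod 4))
    (hK : ∀ x, (∀ w ∈ K, z4Inner x w = 0) → x ∈ K) (P : Finset (Fin n)) :
    ∀ x, (∀ w ∈ evenOn K P, z4Inner x w = 0) →
      ∃ c ∈ K, (∀ p, x p - c p = 0 ∨ x p - c p = 2) ∧ ∀ p ∉ P, x p = c p := by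
  classical
  induction P using Finset.induction_on with
  | empty =>
    intro x hx
    refine ⟨x, hK x fun w hw => hx w ⟨hw, by simp⟩, fun p => by simp, fun p _ => rfl⟩
  | insert q P hq ih =>
    intro x hx
    have hy : IsEvenVec (Pi.single q (2 : ZMod 4) : Fin n → ZMod 4) := by
      intro i
      by_cases h : i = q
      · subst h; right; simp
      · left; simp [h]
    have hin : ∀ w : Fin n → ZMod 4, z4Inner (Pi.single q (2 : ZMod 4)) w = 2 * w q := by
      intro w
      unfold z4Inner
      rw [Finset.sum_eq_single q]
      · simp
      · intro b _ hb; simp [hb]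
      · simp
    have := adj (evenOn K P) hy x (by
      intro w hw h
      rw [hin] at h
      apply hx
      refine ⟨hw.1, fun p hp => ?_⟩
      rcases Finset.mem_insert.1 hp with rfl | hp
      · exact h
      · exact hw.2 p hp)
    rcases this with h | h
    · obtain ⟨c, hc, h1, h2⟩ := ih x h
      exact ⟨c, hc, h1, fun p hp => h2 p fun h => hp (Finset.mem_insert_of_mem h)⟩
    · obtain ⟨c, hc, h1, h2⟩ := ih _ h
      refine ⟨c, hc, fun p => ?_, fun p hp => ?_⟩
      · have ha := h1 p
        have hb := hy p
        rw [Pi.sub_apply] at ha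
        revert ha hb
        generalize (Pi.single q (2 : ZMod 4) : Fin n → ZMod 4) p = b
        generalize x p = a
        generalize c p = d
        revert a b d
        decide
      · have h3 := h2 p fun h => hp (Finset.mem_insert_of_mem h)
        have : p ≠ q := fun h => hp (by simp [h])
        simpa [this] using h3

/-- Krawtchouk numbers: `b` points with sign, `m` points without -/
def kr (j b m : ℕ) : ℤ :=
  ∑ s ∈ Finset.range (j + 1), (-1) ^ s * (b.choose s : ℤ) * (m.choose (j - s) : ℤ)

lemma coeff_one_sub (b s : ℕ) :
    ((1 - Polynomial.X : Polynomial ℤ) ^ b).coeff s = (-1) ^ s * (b.choose s : ℤ) := by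
  induction b generalizing s with
  | zero => cases s <;> simp [Polynomial.coeff_one]
  | succ b ih =>
    rw [pow_succ, mul_sub, mul_one, Polynomial.coeff_sub, ih]
    cases s with
    | zero => simp
    | succ s =>
      rw [Polynomial.coeff_mul_X, ih, Nat.choose_succ_succ]
      push_cast
      ring

lemma kr_sum {α : Type*} [DecidableEq α] (R B : Finset α) (hB : B ⊆ R) (j : ℕ) :
    ∑ x ∈ Finset.powersetCard j R, (-1 : ℤ) ^ (x ∩ B).card
      = kr j B.card (R.card - B.card) := by
  have h1 : (∏ p ∈ R, (1 + (if p ∈ B then -Polynomial.X else Polynomial.X : Polynomial ℤ))).coeff j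
      = ∑ x ∈ Finset.powersetCard j R, (-1 : ℤ) ^ (x ∩ B).card := by
    rw [Finset.prod_one_add, Polynomial.finsetSum_coeff,
      Finset.powersetCard_eq_filter, Finset.sum_filter]
    apply Finset.sum_congr rfl
    intro t _
    have : ∏ i ∈ t, (if i ∈ B then -Polynomial.X else Polynomial.X : Polynomial ℤ)
        = Polynomial.C ((-1 : ℤ) ^ (t ∩ B).card) * Polynomial.X ^ t.card := by
      have h : ∀ i ∈ t, (if i ∈ B then -Polynomial.X else Polynomial.X : Polynomial ℤ)
          = (if i ∈ B then Polynomial.C (-1 : ℤ) else 1) * Polynomial.X := by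
        intro i _
        split_ifs <;> simp
      rw [Finset.prod_congr rfl h, Finset.prod_mul_distrib, Finset.prod_const,
        Finset.prod_ite, Finset.prod_const, Finset.prod_const_one, mul_one,
        Finset.filter_mem_eq_inter, Polynomial.C_pow]
    rw [this, Polynomial.coeff_C_mul_X_pow]
    simp [eq_comm]
  have h2 : (∏ p ∈ R, (1 + (if p ∈ B then -Polynomial.X else Polynomial.X : Polynomial ℤ)))
      = (1 - Polynomial.X) ^ B.card * (1 + Polynomial.X) ^ (R.card - B.card) := by
    rw [← Finset.card_sdiff_of_subset hB, ← Finset.prod_const, ← Finset.prod_const,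
      ← Finset.prod_sdiff hB, mul_comm]
    congr 1
    · exact Finset.prod_congr rfl fun i hi => by simp [hi, sub_eq_add_neg]
    · exact Finset.prod_congr rfl fun i hi => by simp [(Finset.mem_sdiff.1 hi).2]
  rw [← h1, h2, Polynomial.coeff_mul, Finset.Nat.sum_antidiagonal_eq_sum_range_succ_mk]
  unfold kr
  apply Finset.sum_congr rfl
  intro s _
  rw [coeff_one_sub, Polynomial.coeff_one_add_X_pow]

structure Good {n : ℕ} (K : Submodule (ZMod 4) (Fin n → ZMod 4)) : Prop where
  orth : ∀ v ∈ K, ∀ w ∈ K, z4Inner v w = 0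
  dual : ∀ x, (∀ w ∈ K, z4Inner x w = 0) → x ∈ K
  ones : ∃ o ∈ K, ∀ p, o p = 1 ∨ o p = 3
  dvd : ∀ w ∈ K, 8 ∣ (oddS w).card + 4 * (Sset w 2).card
  res4 : ∀ w ∈ K, 4 ∣ (oddS w).card
  res12 : ∀ w ∈ K, (oddS w).card = 0 ∨ 12 ≤ (oddS w).card
  min : ∀ w ∈ K, w ≠ 0 → 24 < (oddS w).card + 4 * (Sset w 2).card

open Classical in
/-- codewords with `i` odd entries -/
noncomputable def lev {n : ℕ} (K : Submodule (ZMod 4) (Fin n → ZMod 4)) (i : ℕ) :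
    Finset (Fin n → ZMod 4) :=
  Finset.univ.filter fun v => v ∈ K ∧ (oddS v).card = i

open Classical in
/-- codewords whose odd part is disjoint from that of `v` -/
noncomputable def dis {n : ℕ} (K : Submodule (ZMod 4) (Fin n → ZMod 4)) (v : Fin n → ZMod 4) :
    Finset (Fin n → ZMod 4) :=
  Finset.univ.filter fun w => w ∈ K ∧ Disjoint (oddS v) (oddS w)

/-- the sign attached to a pair -/
def sg {n : ℕ} (v w : Fin n → ZMod 4) : ℤ := (-1) ^ (Sset v 2 ∩ oddS w).card

noncomputable def M {n : ℕ} (K : Submodule (ZMod 4) (Fin n → ZMod 4)) (i j : ℕ) : ℤ :=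
  ∑ v ∈ lev K i, ∑ w ∈ (dis K v).filter (fun w => (oddS w).card = j), sg v w

lemma mem_lev {n : ℕ} (K : Submodule (ZMod 4) (Fin n → ZMod 4)) (i : ℕ) (v : Fin n → ZMod 4) :
    v ∈ lev K i ↔ v ∈ K ∧ (oddS v).card = i := by simp [lev]

lemma mem_dis {n : ℕ} (K : Submodule (ZMod 4) (Fin n → ZMod 4)) (v w : Fin n → ZMod 4) :
    w ∈ dis K v ↔ w ∈ K ∧ Disjoint (oddS v) (oddS w) := by simp [dis]

lemma two_mul_card {m : ℕ} (h : (2 : ZMod 4) * (m : ZMod 4) = 0) : Even m := by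
  have h' : ((2 * m : ℕ) : ZMod 4) = 0 := by push_cast; exact h
  rw [ZMod.natCast_eq_zero_iff] at h'
  rw [Nat.even_iff]; omega

lemma pt_mul : ∀ a b : ZMod 4, ¬ ((a = 1 ∨ a = 3) ∧ (b = 1 ∨ b = 3)) →
    a * b = 2 * (if a = 2 ∧ (b = 1 ∨ b = 3) then 1 else 0)
      + 2 * (if b = 2 ∧ (a = 1 ∨ a = 3) then 1 else 0) := by decide

lemma card_inter {n : ℕ} (v w : Fin n → ZMod 4) :
    ((Sset v 2 ∩ oddS w).card : ZMod 4)
      = ∑ p, (if v p = 2 ∧ (w p = 1 ∨ w p = 3) then (1 : ZMod 4) else 0) := by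
  rw [Finset.sum_boole]
  congr 2
  ext p
  simp [mem_oddS, mem_two]

lemma inner_dis {n : ℕ} (v w : Fin n → ZMod 4) (h : Disjoint (oddS v) (oddS w)) :
    z4Inner v w = 2 * (((Sset v 2 ∩ oddS w).card + (Sset w 2 ∩ oddS v).card : ℕ) : ZMod 4) := by
  push_cast
  rw [card_inter, card_inter, mul_add, Finset.mul_sum, Finset.mul_sum, ← Finset.sum_add_distrib]
  apply Finset.sum_congr rfl
  intro p _
  apply pt_mul
  rintro ⟨h1, h2⟩
  exact Finset.disjoint_left.1 h ((mem_oddS v p).2 h1) ((mem_oddS w p).2 h2)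

lemma sg_symm {n : ℕ} {K : Submodule (ZMod 4) (Fin n → ZMod 4)} (G : Good K)
    {v w : Fin n → ZMod 4} (hv : v ∈ K) (hw : w ∈ K) (h : Disjoint (oddS v) (oddS w)) :
    sg v w = sg w v := by
  have := G.orth v hv w hw
  rw [inner_dis v w h] at this
  have := two_mul_card this
  unfold sg
  rw [Nat.even_add] at this
  exact neg_one_pow_congr this

lemma M_symm {n : ℕ} {K : Submodule (ZMod 4) (Fin n → ZMod 4)} (G : Good K) (i j : ℕ) :
    M K i j = M K j i := by
  unfold M
  rw [Finset.sum_comm' (t' := lev K j)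
    (s' := fun w => (dis K w).filter (fun v => (oddS v).card = i))]
  · apply Finset.sum_congr rfl
    intro w hw
    apply Finset.sum_congr rfl
    intro v hv
    rw [mem_lev] at hw
    rw [Finset.mem_filter, mem_dis] at hv
    exact sg_symm G hv.1.1 hw.1 hv.1.2.symm
  · intro v w
    simp only [mem_lev, Finset.mem_filter, mem_dis]
    rw [disjoint_comm]
    tauto

lemma M_nonneg {n : ℕ} {K : Submodule (ZMod 4) (Fin n → ZMod 4)} (G : Good K) (j : ℕ) :
    0 ≤ M K 0 j := by
  rw [M_symm G]
  refine Finset.sum_nonneg fun v _ => Finset.sum_nonneg fun w hw => ?_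
  rw [Finset.mem_filter, Finset.card_eq_zero] at hw
  simp [sg, hw.2]

lemma M_pos {n : ℕ} {K : Submodule (ZMod 4) (Fin n → ZMod 4)} :
    0 < M K 0 0 := by
  have ho : oddS (0 : Fin n → ZMod 4) = ∅ := by
    ext p; rw [mem_oddS]; simp; decide
  refine Finset.sum_pos (fun v _ => Finset.sum_pos (fun w hw => ?_) ⟨0, ?_⟩) ⟨0, ?_⟩
  · rw [Finset.mem_filter, Finset.card_eq_zero] at hw
    simp [sg, hw.2]
  · simp [mem_dis, ho]
  · simp [mem_lev, ho]

lemma pt_comp : ∀ o a b : ZMod 4, (o = 1 ∨ o = 3) → ¬ ((a = 1 ∨ a = 3) ∧ (b = 1 ∨ b = 3)) →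
    ((o - a - b = 1 ∨ o - a - b = 3) ↔ ¬ ((a = 1 ∨ a = 3) ∨ (b = 1 ∨ b = 3))) := by
  rintro o a b (rfl | rfl) <;> revert a b <;> decide

lemma odd_comp {n : ℕ} (o v w : Fin n → ZMod 4) (ho : ∀ p, o p = 1 ∨ o p = 3)
    (h : Disjoint (oddS v) (oddS w)) : oddS (o - v - w) = (oddS v ∪ oddS w)ᶜ := by
  ext p
  rw [Finset.mem_compl, Finset.mem_union, mem_oddS, mem_oddS, mem_oddS]
  apply pt_comp _ _ _ (ho p)
  rintro ⟨h1, h2⟩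
  exact Finset.disjoint_left.1 h ((mem_oddS v p).2 h1) ((mem_oddS w p).2 h2)

lemma two_disj {n : ℕ} (v : Fin n → ZMod 4) : Disjoint (Sset v 2) (oddS v) := by
  rw [Finset.disjoint_left]
  intro p
  rw [mem_two, mem_oddS]
  generalize v p = a
  revert a
  decide

lemma sg_comp {n : ℕ} {K : Submodule (ZMod 4) (Fin n → ZMod 4)} (G : Good K)
    (o v w : Fin n → ZMod 4) (ho : ∀ p, o p = 1 ∨ o p = 3) (hv : v ∈ K)
    (h : Disjoint (oddS v) (oddS w)) :
    sg v w = (-1) ^ ((oddS v).card / 4) * sg v (o - v - w) := by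
  have h1 : (Sset v 2 ∩ oddS w).card + (Sset v 2 ∩ oddS (o - v - w)).card = (Sset v 2).card := by
    rw [← Finset.card_union_of_disjoint, ← Finset.inter_union_distrib_left, odd_comp o v w ho h]
    · congr 1
      rw [Finset.inter_eq_left]
      intro p hp
      have := Finset.disjoint_left.1 (two_disj v) hp
      simp only [Finset.mem_union, Finset.mem_compl]
      tauto
    · apply Finset.disjoint_of_subset_left Finset.inter_subset_right
      apply Finset.disjoint_of_subset_right Finset.inter_subset_right
      rw [odd_comp o v w ho h, Finset.disjoint_left]
      intro p hp
      simp [hp]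
  have h8 := G.dvd v hv
  have h4 := G.res4 v hv
  unfold sg
  rw [← pow_add]
  apply neg_one_pow_congr
  rw [Nat.even_iff, Nat.even_iff]
  omega

lemma dis_comp {n : ℕ} {K : Submodule (ZMod 4) (Fin n → ZMod 4)}
    (o v w : Fin n → ZMod 4) (hoK : o ∈ K) (ho : ∀ p, o p = 1 ∨ o p = 3) (hv : v ∈ K)
    (hw : w ∈ dis K v) :
    o - v - w ∈ dis K v ∧ (oddS (o - v - w)).card + (oddS v).card + (oddS w).card = n := by
  rw [mem_dis] at hw ⊢
  refine ⟨⟨K.sub_mem (K.sub_mem hoK hv) hw.1, ?_⟩, ?_⟩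
  · rw [odd_comp o v w ho hw.2, Finset.disjoint_left]
    intro p hp
    simp [hp]
  · rw [odd_comp o v w ho hw.2, add_assoc, ← Finset.card_union_of_disjoint hw.2]
    have := Finset.card_compl_add_card (oddS v ∪ oddS w)
    simpa using this

lemma M_comp {n : ℕ} {K : Submodule (ZMod 4) (Fin n → ZMod 4)} (G : Good K) (i j l : ℕ)
    (hl : i + j + l = n) :
    M K i j = (-1) ^ (i / 4) * M K i l := by
  obtain ⟨o, hoK, ho⟩ := G.ones
  unfold M
  rw [Finset.mul_sum]
  apply Finset.sum_congr rfl
  intro v hv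
  rw [mem_lev] at hv
  rw [Finset.mul_sum]
  apply Finset.sum_nbij' (fun w => o - v - w) (fun w => o - v - w)
  · intro w hw
    rw [Finset.mem_filter] at hw ⊢
    have := dis_comp o v w hoK ho hv.1 hw.1
    exact ⟨this.1, by omega⟩
  · intro w hw
    rw [Finset.mem_filter] at hw ⊢
    have := dis_comp o v w hoK ho hv.1 hw.1
    exact ⟨this.1, by omega⟩
  · intro w _; simp
  · intro w _; simp
  · intro w hw
    rw [Finset.mem_filter, mem_dis] at hw
    rw [← hv.2]
    exact sg_comp G o v w ho hv.1 hw.1.2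

lemma M_zero {n : ℕ} {K : Submodule (ZMod 4) (Fin n → ZMod 4)} (G : Good K) (i l : ℕ)
    (h : ¬ (4 ∣ l ∧ (l = 0 ∨ 12 ≤ l))) : M K i l = 0 := by
  unfold M
  refine Finset.sum_eq_zero fun v _ => ?_
  apply Finset.sum_eq_zero
  intro w hw
  exfalso
  rw [Finset.mem_filter, mem_dis] at hw
  have h1 := G.res4 w hw.1.1
  have h2 := G.res12 w hw.1.1
  rw [hw.2] at h1 h2
  exact h ⟨h1, h2⟩

lemma inner_zero_or {n : ℕ} {K : Submodule (ZMod 4) (Fin n → ZMod 4)} (G : Good K)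
    (v : Fin n → ZMod 4) (hv : v ∈ K) (x : Finset (Fin n)) (hx : x ⊆ (oddS v)ᶜ)
    (hno : ∀ w ∈ K, (oddS w).card = (oddS v).card → (Sset w 2).card = x.card → False) :
    ∑ w ∈ dis K v, sg v w * (-1) ^ (x ∩ oddS w).card = 0 := by
  set y : Fin n → ZMod 4 := fun p =>
    (if v p = 2 then 2 else 0) + (if p ∈ x then 2 else 0) with hy
  have hye : IsEvenVec y := by
    intro p
    simp only [hy]
    split_ifs <;> decide
  have hyw : ∀ w, z4Inner y w = 2 * (((Sset v 2 ∩ oddS w).card + (x ∩ oddS w).card : ℕ) : ZMod 4) := by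
    intro w
    have hx2 : ((x ∩ oddS w).card : ZMod 4)
        = ∑ p, (if p ∈ x ∧ (w p = 1 ∨ w p = 3) then (1 : ZMod 4) else 0) := by
      rw [Finset.sum_boole]
      congr 2
      ext p
      simp [mem_oddS]
    push_cast
    rw [card_inter, hx2, mul_add, Finset.mul_sum, Finset.mul_sum, ← Finset.sum_add_distrib]
    apply Finset.sum_congr rfl
    intro p _
    simp only [hy]
    generalize w p = b
    by_cases h1 : v p = 2 <;> by_cases h2 : p ∈ x <;> simp only [h1, h2, true_and, false_and, if_true, if_false] <;> revert b <;> decide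
  have hterm : ∀ w, sg v w * (-1) ^ (x ∩ oddS w).card = if z4Inner y w = 0 then (1 : ℤ) else -1 := by
    intro w
    unfold sg
    rw [← pow_add]
    split_ifs with h
    · rw [hyw] at h
      exact (two_mul_card h).neg_one_pow
    · rw [hyw] at h
      apply Odd.neg_one_pow
      rw [← Nat.not_even_iff_odd]
      rintro ⟨r, hr⟩
      apply h
      rw [hr]
      push_cast
      rw [← two_mul, ← mul_assoc]
      have : (2 : ZMod 4) * 2 = 0 := by decide
      rw [this, zero_mul]
  simp only [hterm]
  have hdis : ∀ w, w ∈ dis K v ↔ w ∈ evenOn K (oddS v) := by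
    intro w
    rw [mem_dis, mem_evenOn, Finset.disjoint_left]
    refine and_congr_right fun _ => forall_congr' fun p => imp_congr_right fun _ => ?_
    rw [mem_oddS]
    generalize w p = a
    revert a
    decide
  by_cases hall : ∀ w ∈ evenOn K (oddS v), z4Inner y w = 0
  · exfalso
    obtain ⟨c, hc, h1, h2⟩ := dual_evenOn K G.dual (oddS v) y hall
    have hce : ∀ p, c p = 0 ∨ c p = 2 := by
      intro p
      have ha := h1 p
      have hb := hye p
      revert ha hb
      generalize y p = a
      generalize c p = b
      revert a b
      decide
    have hodd : oddS (v + c) = oddS v := by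
      ext p
      rw [mem_oddS, mem_oddS, Pi.add_apply]
      have := hce p
      revert this
      generalize v p = a
      generalize c p = b
      revert a b
      decide
    apply hno (v + c) (K.add_mem hv hc)
    · rw [hodd]
    · congr 1
      ext p
      rw [mem_two, Pi.add_apply]
      by_cases hp : p ∈ oddS v
      · have hpx : p ∉ x := fun h => by simpa [hp] using hx h
        have := hce p
        rw [mem_oddS] at hp
        simp only [hpx, iff_false]
        revert this hp
        generalize v p = a
        generalize c p = b
        revert a b
        decide
      · rw [← h2 p hp]
        rw [mem_oddS] at hp
        simp only [hy]
        revert hp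
        generalize v p = a
        by_cases hpx : p ∈ x <;> simp only [hpx, if_true, if_false] <;> revert a <;> decide
  · push Not at hall
    obtain ⟨w0, hw0, hyw0⟩ := hall
    have e0 : z4Inner y w0 = 2 := (even_two_mul hye w0).resolve_left hyw0
    have hflip : ∑ w ∈ dis K v, (if z4Inner y w = 0 then (1 : ℤ) else -1)
        = ∑ w ∈ dis K v, -(if z4Inner y w = 0 then (1 : ℤ) else -1) := by
      apply Finset.sum_nbij' (fun w => w + w0) (fun w => w - w0)
      · intro w hw
        rw [hdis] at hw ⊢
        exact (evenOn K (oddS v)).add_mem hw hw0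
      · intro w hw
        rw [hdis] at hw ⊢
        exact (evenOn K (oddS v)).sub_mem hw hw0
      · intro w _; simp
      · intro w _; simp
      · intro w _
        rw [z4Inner_add_right, e0]
        rcases even_two_mul hye w with h | h <;> rw [h] <;> decide
    rw [Finset.sum_neg_distrib] at hflip
    linarith

lemma M_eq {n : ℕ} {K : Submodule (ZMod 4) (Fin n → ZMod 4)} (G : Good K) (i j : ℕ)
    (h0 : i + 4 * j ≠ 0) (h24 : i + 4 * j ≤ 24) :
    ∑ l ∈ Finset.range (n - i + 1), M K i l * kr j l (n - i - l) = 0 := by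
  unfold M
  simp only [Finset.sum_mul]
  rw [Finset.sum_comm]
  refine Finset.sum_eq_zero fun v hv => ?_
  rw [mem_lev] at hv
  have hin : ∀ w ∈ dis K v, oddS w ⊆ (oddS v)ᶜ := by
    intro w hw p hp
    rw [Finset.mem_compl]
    rw [mem_dis] at hw
    exact fun h => Finset.disjoint_left.1 hw.2 h hp
  have hc : ((oddS v)ᶜ).card = n - i := by
    rw [Finset.card_compl, hv.2]; simp
  have h1 : ∀ l, ∑ w ∈ (dis K v).filter (fun w => (oddS w).card = l), sg v w * kr j l (n - i - l)
      = ∑ w ∈ (dis K v).filter (fun w => (oddS w).card = l),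
        sg v w * ∑ x ∈ Finset.powersetCard j (oddS v)ᶜ, (-1 : ℤ) ^ (x ∩ oddS w).card := by
    intro l
    apply Finset.sum_congr rfl
    intro w hw
    rw [Finset.mem_filter] at hw
    rw [kr_sum _ _ (hin w hw.1), hc, hw.2]
  simp only [h1]
  rw [Finset.sum_fiberwise_of_maps_to]
  · simp only [Finset.mul_sum]
    rw [Finset.sum_comm]
    refine Finset.sum_eq_zero fun x hx => ?_
    rw [Finset.mem_powersetCard] at hx
    apply inner_zero_or G v hv.1 x hx.1
    intro w hw hw1 hw2
    rw [hv.2] at hw1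
    rw [hx.2] at hw2
    have hne : w ≠ 0 := by
      rintro rfl
      have e1 : oddS (0 : Fin n → ZMod 4) = ∅ := by
        ext p; rw [mem_oddS]; simp; decide
      have e2 : Sset (0 : Fin n → ZMod 4) 2 = ∅ := by
        ext p; rw [mem_two]; simp; decide
      rw [e1] at hw1
      rw [e2] at hw2
      simp at hw1 hw2
      omega
    have := G.min w hw hne
    omega
  · intro w hw
    have := Finset.card_le_card (hin w hw)
    rw [Finset.mem_range]
    omega

lemma M_eq' {n : ℕ} {K : Submodule (ZMod 4) (Fin n → ZMod 4)} (G : Good K) (i j : ℕ)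
    (h0 : i + 4 * j ≠ 0) (h24 : i + 4 * j ≤ 24) :
    ∑ l ∈ (Finset.range (n - i + 1)).filter
      (fun l => (4 ∣ l ∧ (l = 0 ∨ 12 ≤ l)) ∧ (n - i - l = 0 ∨ 12 ≤ n - i - l)),
      M K i l * kr j l (n - i - l) = 0 := by
  rw [← M_eq G i j h0 h24]
  apply Finset.sum_filter_of_ne
  intro l hl hne
  rw [Finset.mem_range] at hl
  have hM : M K i l ≠ 0 := fun h => hne (by rw [h, zero_mul])
  have hi : i ≤ n ∨ n < i := le_or_gt i n
  constructor
  · by_contra h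
    exact hM (M_zero G i l h)
  · by_cases hin : i ≤ n
    · by_contra h
      apply hM
      rw [M_comp G i l (n - i - l) (by omega), M_zero G i (n - i - l) (by omega), mul_zero]
    · omega

set_option maxHeartbeats 2000000 in
lemma no_48 (K : Submodule (ZMod 4) (Fin 48 → ZMod 4)) (G : Good K) : False := by
  have z0 := M_pos (K := K)
  have z12 := M_nonneg G 12
  have z16 := M_nonneg G 16
  have z20 := M_nonneg G 20
  have z24 := M_nonneg G 24
  have f0 : (Finset.range (48 - 0 + 1)).filter
      (fun l => (4 ∣ l ∧ (l = 0 ∨ 12 ≤ l)) ∧ (48 - 0 - l = 0 ∨ 12 ≤ 48 - 0 - l)) = {0, 12, 16, 20, 24, 28, 32, 36, 48} := by decide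
  have e0_2 := M_eq' G 0 2 (by norm_num) (by norm_num)
  rw [f0] at e0_2
  norm_num [kr, Finset.sum_range_succ, Nat.choose_eq_descFactorial_div_factorial,
    Nat.descFactorial, Nat.factorial] at e0_2
  have e0_4 := M_eq' G 0 4 (by norm_num) (by norm_num)
  rw [f0] at e0_4
  norm_num [kr, Finset.sum_range_succ, Nat.choose_eq_descFactorial_div_factorial,
    Nat.descFactorial, Nat.factorial] at e0_4
  have e0_6 := M_eq' G 0 6 (by norm_num) (by norm_num)
  rw [f0] at e0_6
  norm_num [kr, Finset.sum_range_succ, Nat.choose_eq_descFactorial_div_factorial,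
    Nat.descFactorial, Nat.factorial] at e0_6
  have r0_28 : M K 0 28 = M K 0 20 := by
    have h0 := M_comp G 0 28 20 rfl
    norm_num at h0
    linarith only [h0]
  have r0_32 : M K 0 32 = M K 0 16 := by
    have h0 := M_comp G 0 32 16 rfl
    norm_num at h0
    linarith only [h0]
  have r0_36 : M K 0 36 = M K 0 12 := by
    have h0 := M_comp G 0 36 12 rfl
    norm_num at h0
    linarith only [h0]
  have r0_48 : M K 0 48 = M K 0 0 := by
    have h0 := M_comp G 0 48 0 rfl
    norm_num at h0
    linarith only [h0]
  have f12 : (Finset.range (48 - 12 + 1)).filter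
      (fun l => (4 ∣ l ∧ (l = 0 ∨ 12 ≤ l)) ∧ (48 - 12 - l = 0 ∨ 12 ≤ 48 - 12 - l)) = {0, 12, 16, 20, 24, 36} := by decide
  have e12_1 := M_eq' G 12 1 (by norm_num) (by norm_num)
  rw [f12] at e12_1
  norm_num [kr, Finset.sum_range_succ, Nat.choose_eq_descFactorial_div_factorial,
    Nat.descFactorial, Nat.factorial] at e12_1
  have e12_3 := M_eq' G 12 3 (by norm_num) (by norm_num)
  rw [f12] at e12_3
  norm_num [kr, Finset.sum_range_succ, Nat.choose_eq_descFactorial_div_factorial,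
    Nat.descFactorial, Nat.factorial] at e12_3
  have r12_0 : M K 12 0 = M K 0 12 := by
    have h0 := M_symm G 12 0
    norm_num at h0
    linarith only [h0]
  have r12_20 : M K 12 20 = -M K 12 16 := by
    have h0 := M_comp G 12 20 16 rfl
    norm_num at h0
    linarith only [h0]
  have r12_24 : M K 12 24 = -M K 12 12 := by
    have h0 := M_comp G 12 24 12 rfl
    norm_num at h0
    linarith only [h0]
  have r12_36 : M K 12 36 = -M K 0 12 := by
    have h0 := M_comp G 12 36 0 rfl
    norm_num at h0
    have h1 := M_symm G 12 0
    norm_num at h1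
    linarith only [h0, h1]
  have f16 : (Finset.range (48 - 16 + 1)).filter
      (fun l => (4 ∣ l ∧ (l = 0 ∨ 12 ≤ l)) ∧ (48 - 16 - l = 0 ∨ 12 ≤ 48 - 16 - l)) = {0, 12, 16, 20, 32} := by decide
  have e16_0 := M_eq' G 16 0 (by norm_num) (by norm_num)
  rw [f16] at e16_0
  norm_num [kr, Finset.sum_range_succ, Nat.choose_eq_descFactorial_div_factorial,
    Nat.descFactorial, Nat.factorial] at e16_0
  have e16_2 := M_eq' G 16 2 (by norm_num) (by norm_num)
  rw [f16] at e16_2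
  norm_num [kr, Finset.sum_range_succ, Nat.choose_eq_descFactorial_div_factorial,
    Nat.descFactorial, Nat.factorial] at e16_2
  have r16_0 : M K 16 0 = M K 0 16 := by
    have h0 := M_symm G 16 0
    norm_num at h0
    linarith only [h0]
  have r16_12 : M K 16 12 = M K 12 16 := by
    have h0 := M_symm G 16 12
    norm_num at h0
    linarith only [h0]
  have r16_20 : M K 16 20 = M K 12 16 := by
    have h0 := M_comp G 16 20 12 rfl
    norm_num at h0
    have h1 := M_symm G 16 12
    norm_num at h1
    linarith only [h0, h1]
  have r16_32 : M K 16 32 = M K 0 16 := by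
    have h0 := M_comp G 16 32 0 rfl
    norm_num at h0
    have h1 := M_symm G 16 0
    norm_num at h1
    linarith only [h0, h1]
  have f20 : (Finset.range (48 - 20 + 1)).filter
      (fun l => (4 ∣ l ∧ (l = 0 ∨ 12 ≤ l)) ∧ (48 - 20 - l = 0 ∨ 12 ≤ 48 - 20 - l)) = {0, 12, 16, 28} := by decide
  have e20_1 := M_eq' G 20 1 (by norm_num) (by norm_num)
  rw [f20] at e20_1
  norm_num [kr, Finset.sum_range_succ, Nat.choose_eq_descFactorial_div_factorial,
    Nat.descFactorial, Nat.factorial] at e20_1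
  have r20_0 : M K 20 0 = M K 0 20 := by
    have h0 := M_symm G 20 0
    norm_num at h0
    linarith only [h0]
  have r20_12 : M K 20 12 = -M K 12 16 := by
    have h0 := M_symm G 20 12
    norm_num at h0
    have h1 := M_comp G 12 20 16 rfl
    norm_num at h1
    linarith only [h0, h1]
  have r20_16 : M K 20 16 = M K 12 16 := by
    have h0 := M_symm G 20 16
    norm_num at h0
    have h1 := M_comp G 16 20 12 rfl
    norm_num at h1
    have h2 := M_symm G 16 12
    norm_num at h2
    linarith only [h0, h1, h2]
  have r20_28 : M K 20 28 = -M K 0 20 := by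
    have h0 := M_comp G 20 28 0 rfl
    norm_num at h0
    have h1 := M_symm G 20 0
    norm_num at h1
    linarith only [h0, h1]
  have f24 : (Finset.range (48 - 24 + 1)).filter
      (fun l => (4 ∣ l ∧ (l = 0 ∨ 12 ≤ l)) ∧ (48 - 24 - l = 0 ∨ 12 ≤ 48 - 24 - l)) = {0, 12, 24} := by decide
  have e24_0 := M_eq' G 24 0 (by norm_num) (by norm_num)
  rw [f24] at e24_0
  norm_num [kr, Finset.sum_range_succ, Nat.choose_eq_descFactorial_div_factorial,
    Nat.descFactorial, Nat.factorial] at e24_0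
  have r24_0 : M K 24 0 = M K 0 24 := by
    have h0 := M_symm G 24 0
    norm_num at h0
    linarith only [h0]
  have r24_12 : M K 24 12 = -M K 12 12 := by
    have h0 := M_symm G 24 12
    norm_num at h0
    have h1 := M_comp G 12 24 12 rfl
    norm_num at h1
    linarith only [h0, h1]
  have r24_24 : M K 24 24 = M K 0 24 := by
    have h0 := M_comp G 24 24 0 rfl
    norm_num at h0
    have h1 := M_symm G 24 0
    norm_num at h1
    linarith only [h0, h1]
  linarith

set_option maxHeartbeats 2000000 in
lemma no_56 (K : Submodule (ZMod 4) (Fin 56 → ZMod 4)) (G : Good K) : False := by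
  have z0 := M_pos (K := K)
  have z12 := M_nonneg G 12
  have z16 := M_nonneg G 16
  have z20 := M_nonneg G 20
  have z24 := M_nonneg G 24
  have z28 := M_nonneg G 28
  have f0 : (Finset.range (56 - 0 + 1)).filter
      (fun l => (4 ∣ l ∧ (l = 0 ∨ 12 ≤ l)) ∧ (56 - 0 - l = 0 ∨ 12 ≤ 56 - 0 - l)) = {0, 12, 16, 20, 24, 28, 32, 36, 40, 44, 56} := by decide
  have e0_2 := M_eq' G 0 2 (by norm_num) (by norm_num)
  rw [f0] at e0_2
  norm_num [kr, Finset.sum_range_succ, Nat.choose_eq_descFactorial_div_factorial,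
    Nat.descFactorial, Nat.factorial] at e0_2
  have e0_4 := M_eq' G 0 4 (by norm_num) (by norm_num)
  rw [f0] at e0_4
  norm_num [kr, Finset.sum_range_succ, Nat.choose_eq_descFactorial_div_factorial,
    Nat.descFactorial, Nat.factorial] at e0_4
  have e0_6 := M_eq' G 0 6 (by norm_num) (by norm_num)
  rw [f0] at e0_6
  norm_num [kr, Finset.sum_range_succ, Nat.choose_eq_descFactorial_div_factorial,
    Nat.descFactorial, Nat.factorial] at e0_6
  have r0_32 : M K 0 32 = M K 0 24 := by
    have h0 := M_comp G 0 32 24 rfl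
    norm_num at h0
    linarith only [h0]
  have r0_36 : M K 0 36 = M K 0 20 := by
    have h0 := M_comp G 0 36 20 rfl
    norm_num at h0
    linarith only [h0]
  have r0_40 : M K 0 40 = M K 0 16 := by
    have h0 := M_comp G 0 40 16 rfl
    norm_num at h0
    linarith only [h0]
  have r0_44 : M K 0 44 = M K 0 12 := by
    have h0 := M_comp G 0 44 12 rfl
    norm_num at h0
    linarith only [h0]
  have r0_56 : M K 0 56 = M K 0 0 := by
    have h0 := M_comp G 0 56 0 rfl
    norm_num at h0
    linarith only [h0]
  have f12 : (Finset.range (56 - 12 + 1)).filter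
      (fun l => (4 ∣ l ∧ (l = 0 ∨ 12 ≤ l)) ∧ (56 - 12 - l = 0 ∨ 12 ≤ 56 - 12 - l)) = {0, 12, 16, 20, 24, 28, 32, 44} := by decide
  have e12_1 := M_eq' G 12 1 (by norm_num) (by norm_num)
  rw [f12] at e12_1
  norm_num [kr, Finset.sum_range_succ, Nat.choose_eq_descFactorial_div_factorial,
    Nat.descFactorial, Nat.factorial] at e12_1
  have e12_3 := M_eq' G 12 3 (by norm_num) (by norm_num)
  rw [f12] at e12_3
  norm_num [kr, Finset.sum_range_succ, Nat.choose_eq_descFactorial_div_factorial,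
    Nat.descFactorial, Nat.factorial] at e12_3
  have r12_0 : M K 12 0 = M K 0 12 := by
    have h0 := M_symm G 12 0
    norm_num at h0
    linarith only [h0]
  have r12_24 : M K 12 24 = -M K 12 20 := by
    have h0 := M_comp G 12 24 20 rfl
    norm_num at h0
    linarith only [h0]
  have r12_28 : M K 12 28 = -M K 12 16 := by
    have h0 := M_comp G 12 28 16 rfl
    norm_num at h0
    linarith only [h0]
  have r12_32 : M K 12 32 = -M K 12 12 := by
    have h0 := M_comp G 12 32 12 rfl
    norm_num at h0
    linarith only [h0]
  have r12_44 : M K 12 44 = -M K 0 12 := by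
    have h0 := M_comp G 12 44 0 rfl
    norm_num at h0
    have h1 := M_symm G 12 0
    norm_num at h1
    linarith only [h0, h1]
  have f16 : (Finset.range (56 - 16 + 1)).filter
      (fun l => (4 ∣ l ∧ (l = 0 ∨ 12 ≤ l)) ∧ (56 - 16 - l = 0 ∨ 12 ≤ 56 - 16 - l)) = {0, 12, 16, 20, 24, 28, 40} := by decide
  have e16_0 := M_eq' G 16 0 (by norm_num) (by norm_num)
  rw [f16] at e16_0
  norm_num [kr, Finset.sum_range_succ, Nat.choose_eq_descFactorial_div_factorial,
    Nat.descFactorial, Nat.factorial] at e16_0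
  have e16_2 := M_eq' G 16 2 (by norm_num) (by norm_num)
  rw [f16] at e16_2
  norm_num [kr, Finset.sum_range_succ, Nat.choose_eq_descFactorial_div_factorial,
    Nat.descFactorial, Nat.factorial] at e16_2
  have r16_0 : M K 16 0 = M K 0 16 := by
    have h0 := M_symm G 16 0
    norm_num at h0
    linarith only [h0]
  have r16_12 : M K 16 12 = M K 12 16 := by
    have h0 := M_symm G 16 12
    norm_num at h0
    linarith only [h0]
  have r16_24 : M K 16 24 = M K 16 16 := by
    have h0 := M_comp G 16 24 16 rfl
    norm_num at h0
    linarith only [h0]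
  have r16_28 : M K 16 28 = M K 12 16 := by
    have h0 := M_comp G 16 28 12 rfl
    norm_num at h0
    have h1 := M_symm G 16 12
    norm_num at h1
    linarith only [h0, h1]
  have r16_40 : M K 16 40 = M K 0 16 := by
    have h0 := M_comp G 16 40 0 rfl
    norm_num at h0
    have h1 := M_symm G 16 0
    norm_num at h1
    linarith only [h0, h1]
  have f20 : (Finset.range (56 - 20 + 1)).filter
      (fun l => (4 ∣ l ∧ (l = 0 ∨ 12 ≤ l)) ∧ (56 - 20 - l = 0 ∨ 12 ≤ 56 - 20 - l)) = {0, 12, 16, 20, 24, 36} := by decide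
  have e20_1 := M_eq' G 20 1 (by norm_num) (by norm_num)
  rw [f20] at e20_1
  norm_num [kr, Finset.sum_range_succ, Nat.choose_eq_descFactorial_div_factorial,
    Nat.descFactorial, Nat.factorial] at e20_1
  have r20_0 : M K 20 0 = M K 0 20 := by
    have h0 := M_symm G 20 0
    norm_num at h0
    linarith only [h0]
  have r20_12 : M K 20 12 = M K 12 20 := by
    have h0 := M_symm G 20 12
    norm_num at h0
    linarith only [h0]
  have r20_16 : M K 20 16 = M K 16 20 := by
    have h0 := M_symm G 20 16
    norm_num at h0
    linarith only [h0]
  have r20_20 : M K 20 20 = -M K 16 20 := by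
    have h0 := M_comp G 20 20 16 rfl
    norm_num at h0
    have h1 := M_symm G 20 16
    norm_num at h1
    linarith only [h0, h1]
  have r20_24 : M K 20 24 = -M K 12 20 := by
    have h0 := M_comp G 20 24 12 rfl
    norm_num at h0
    have h1 := M_symm G 20 12
    norm_num at h1
    linarith only [h0, h1]
  have r20_36 : M K 20 36 = -M K 0 20 := by
    have h0 := M_comp G 20 36 0 rfl
    norm_num at h0
    have h1 := M_symm G 20 0
    norm_num at h1
    linarith only [h0, h1]
  have f24 : (Finset.range (56 - 24 + 1)).filter
      (fun l => (4 ∣ l ∧ (l = 0 ∨ 12 ≤ l)) ∧ (56 - 24 - l = 0 ∨ 12 ≤ 56 - 24 - l)) = {0, 12, 16, 20, 32} := by decide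
  have e24_0 := M_eq' G 24 0 (by norm_num) (by norm_num)
  rw [f24] at e24_0
  norm_num [kr, Finset.sum_range_succ, Nat.choose_eq_descFactorial_div_factorial,
    Nat.descFactorial, Nat.factorial] at e24_0
  have r24_0 : M K 24 0 = M K 0 24 := by
    have h0 := M_symm G 24 0
    norm_num at h0
    linarith only [h0]
  have r24_12 : M K 24 12 = -M K 12 20 := by
    have h0 := M_symm G 24 12
    norm_num at h0
    have h1 := M_comp G 12 24 20 rfl
    norm_num at h1
    linarith only [h0, h1]
  have r24_16 : M K 24 16 = M K 16 16 := by
    have h0 := M_symm G 24 16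
    norm_num at h0
    have h1 := M_comp G 16 24 16 rfl
    norm_num at h1
    linarith only [h0, h1]
  have r24_20 : M K 24 20 = -M K 12 20 := by
    have h0 := M_symm G 24 20
    norm_num at h0
    have h1 := M_comp G 20 24 12 rfl
    norm_num at h1
    have h2 := M_symm G 20 12
    norm_num at h2
    linarith only [h0, h1, h2]
  have r24_32 : M K 24 32 = M K 0 24 := by
    have h0 := M_comp G 24 32 0 rfl
    norm_num at h0
    have h1 := M_symm G 24 0
    norm_num at h1
    linarith only [h0, h1]
  linarith

set_option maxHeartbeats 2000000 in
lemma no_64 (K : Submodule (ZMod 4) (Fin 64 → ZMod 4)) (G : Good K) : False := by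
  have z0 := M_pos (K := K)
  have z12 := M_nonneg G 12
  have z16 := M_nonneg G 16
  have z20 := M_nonneg G 20
  have z24 := M_nonneg G 24
  have z28 := M_nonneg G 28
  have z32 := M_nonneg G 32
  have f0 : (Finset.range (64 - 0 + 1)).filter
      (fun l => (4 ∣ l ∧ (l = 0 ∨ 12 ≤ l)) ∧ (64 - 0 - l = 0 ∨ 12 ≤ 64 - 0 - l)) = {0, 12, 16, 20, 24, 28, 32, 36, 40, 44, 48, 52, 64} := by decide
  have e0_2 := M_eq' G 0 2 (by norm_num) (by norm_num)
  rw [f0] at e0_2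
  norm_num [kr, Finset.sum_range_succ, Nat.choose_eq_descFactorial_div_factorial,
    Nat.descFactorial, Nat.factorial] at e0_2
  have e0_4 := M_eq' G 0 4 (by norm_num) (by norm_num)
  rw [f0] at e0_4
  norm_num [kr, Finset.sum_range_succ, Nat.choose_eq_descFactorial_div_factorial,
    Nat.descFactorial, Nat.factorial] at e0_4
  have e0_6 := M_eq' G 0 6 (by norm_num) (by norm_num)
  rw [f0] at e0_6
  norm_num [kr, Finset.sum_range_succ, Nat.choose_eq_descFactorial_div_factorial,
    Nat.descFactorial, Nat.factorial] at e0_6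
  have r0_36 : M K 0 36 = M K 0 28 := by
    have h0 := M_comp G 0 36 28 rfl
    norm_num at h0
    linarith only [h0]
  have r0_40 : M K 0 40 = M K 0 24 := by
    have h0 := M_comp G 0 40 24 rfl
    norm_num at h0
    linarith only [h0]
  have r0_44 : M K 0 44 = M K 0 20 := by
    have h0 := M_comp G 0 44 20 rfl
    norm_num at h0
    linarith only [h0]
  have r0_48 : M K 0 48 = M K 0 16 := by
    have h0 := M_comp G 0 48 16 rfl
    norm_num at h0
    linarith only [h0]
  have r0_52 : M K 0 52 = M K 0 12 := by
    have h0 := M_comp G 0 52 12 rfl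
    norm_num at h0
    linarith only [h0]
  have r0_64 : M K 0 64 = M K 0 0 := by
    have h0 := M_comp G 0 64 0 rfl
    norm_num at h0
    linarith only [h0]
  have f12 : (Finset.range (64 - 12 + 1)).filter
      (fun l => (4 ∣ l ∧ (l = 0 ∨ 12 ≤ l)) ∧ (64 - 12 - l = 0 ∨ 12 ≤ 64 - 12 - l)) = {0, 12, 16, 20, 24, 28, 32, 36, 40, 52} := by decide
  have e12_1 := M_eq' G 12 1 (by norm_num) (by norm_num)
  rw [f12] at e12_1
  norm_num [kr, Finset.sum_range_succ, Nat.choose_eq_descFactorial_div_factorial,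
    Nat.descFactorial, Nat.factorial] at e12_1
  have e12_3 := M_eq' G 12 3 (by norm_num) (by norm_num)
  rw [f12] at e12_3
  norm_num [kr, Finset.sum_range_succ, Nat.choose_eq_descFactorial_div_factorial,
    Nat.descFactorial, Nat.factorial] at e12_3
  have r12_0 : M K 12 0 = M K 0 12 := by
    have h0 := M_symm G 12 0
    norm_num at h0
    linarith only [h0]
  have r12_28 : M K 12 28 = -M K 12 24 := by
    have h0 := M_comp G 12 28 24 rfl
    norm_num at h0
    linarith only [h0]
  have r12_32 : M K 12 32 = -M K 12 20 := by
    have h0 := M_comp G 12 32 20 rfl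
    norm_num at h0
    linarith only [h0]
  have r12_36 : M K 12 36 = -M K 12 16 := by
    have h0 := M_comp G 12 36 16 rfl
    norm_num at h0
    linarith only [h0]
  have r12_40 : M K 12 40 = -M K 12 12 := by
    have h0 := M_comp G 12 40 12 rfl
    norm_num at h0
    linarith only [h0]
  have r12_52 : M K 12 52 = -M K 0 12 := by
    have h0 := M_comp G 12 52 0 rfl
    norm_num at h0
    have h1 := M_symm G 12 0
    norm_num at h1
    linarith only [h0, h1]
  have f16 : (Finset.range (64 - 16 + 1)).filter
      (fun l => (4 ∣ l ∧ (l = 0 ∨ 12 ≤ l)) ∧ (64 - 16 - l = 0 ∨ 12 ≤ 64 - 16 - l)) = {0, 12, 16, 20, 24, 28, 32, 36, 48} := by decide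
  have e16_0 := M_eq' G 16 0 (by norm_num) (by norm_num)
  rw [f16] at e16_0
  norm_num [kr, Finset.sum_range_succ, Nat.choose_eq_descFactorial_div_factorial,
    Nat.descFactorial, Nat.factorial] at e16_0
  have e16_2 := M_eq' G 16 2 (by norm_num) (by norm_num)
  rw [f16] at e16_2
  norm_num [kr, Finset.sum_range_succ, Nat.choose_eq_descFactorial_div_factorial,
    Nat.descFactorial, Nat.factorial] at e16_2
  have r16_0 : M K 16 0 = M K 0 16 := by
    have h0 := M_symm G 16 0
    norm_num at h0
    linarith only [h0]
  have r16_12 : M K 16 12 = M K 12 16 := by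
    have h0 := M_symm G 16 12
    norm_num at h0
    linarith only [h0]
  have r16_28 : M K 16 28 = M K 16 20 := by
    have h0 := M_comp G 16 28 20 rfl
    norm_num at h0
    linarith only [h0]
  have r16_32 : M K 16 32 = M K 16 16 := by
    have h0 := M_comp G 16 32 16 rfl
    norm_num at h0
    linarith only [h0]
  have r16_36 : M K 16 36 = M K 12 16 := by
    have h0 := M_comp G 16 36 12 rfl
    norm_num at h0
    have h1 := M_symm G 16 12
    norm_num at h1
    linarith only [h0, h1]
  have r16_48 : M K 16 48 = M K 0 16 := by
    have h0 := M_comp G 16 48 0 rfl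
    norm_num at h0
    have h1 := M_symm G 16 0
    norm_num at h1
    linarith only [h0, h1]
  have f20 : (Finset.range (64 - 20 + 1)).filter
      (fun l => (4 ∣ l ∧ (l = 0 ∨ 12 ≤ l)) ∧ (64 - 20 - l = 0 ∨ 12 ≤ 64 - 20 - l)) = {0, 12, 16, 20, 24, 28, 32, 44} := by decide
  have e20_1 := M_eq' G 20 1 (by norm_num) (by norm_num)
  rw [f20] at e20_1
  norm_num [kr, Finset.sum_range_succ, Nat.choose_eq_descFactorial_div_factorial,
    Nat.descFactorial, Nat.factorial] at e20_1
  have r20_0 : M K 20 0 = M K 0 20 := by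
    have h0 := M_symm G 20 0
    norm_num at h0
    linarith only [h0]
  have r20_12 : M K 20 12 = M K 12 20 := by
    have h0 := M_symm G 20 12
    norm_num at h0
    linarith only [h0]
  have r20_16 : M K 20 16 = M K 16 20 := by
    have h0 := M_symm G 20 16
    norm_num at h0
    linarith only [h0]
  have r20_24 : M K 20 24 = -M K 20 20 := by
    have h0 := M_comp G 20 24 20 rfl
    norm_num at h0
    linarith only [h0]
  have r20_28 : M K 20 28 = -M K 16 20 := by
    have h0 := M_comp G 20 28 16 rfl
    norm_num at h0
    have h1 := M_symm G 20 16
    norm_num at h1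
    linarith only [h0, h1]
  have r20_32 : M K 20 32 = -M K 12 20 := by
    have h0 := M_comp G 20 32 12 rfl
    norm_num at h0
    have h1 := M_symm G 20 12
    norm_num at h1
    linarith only [h0, h1]
  have r20_44 : M K 20 44 = -M K 0 20 := by
    have h0 := M_comp G 20 44 0 rfl
    norm_num at h0
    have h1 := M_symm G 20 0
    norm_num at h1
    linarith only [h0, h1]
  have f24 : (Finset.range (64 - 24 + 1)).filter
      (fun l => (4 ∣ l ∧ (l = 0 ∨ 12 ≤ l)) ∧ (64 - 24 - l = 0 ∨ 12 ≤ 64 - 24 - l)) = {0, 12, 16, 20, 24, 28, 40} := by decide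
  have e24_0 := M_eq' G 24 0 (by norm_num) (by norm_num)
  rw [f24] at e24_0
  norm_num [kr, Finset.sum_range_succ, Nat.choose_eq_descFactorial_div_factorial,
    Nat.descFactorial, Nat.factorial] at e24_0
  have r24_0 : M K 24 0 = M K 0 24 := by
    have h0 := M_symm G 24 0
    norm_num at h0
    linarith only [h0]
  have r24_12 : M K 24 12 = M K 12 24 := by
    have h0 := M_symm G 24 12
    norm_num at h0
    linarith only [h0]
  have r24_16 : M K 24 16 = M K 16 24 := by
    have h0 := M_symm G 24 16
    norm_num at h0
    linarith only [h0]
  have r24_20 : M K 24 20 = -M K 20 20 := by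
    have h0 := M_symm G 24 20
    norm_num at h0
    have h1 := M_comp G 20 24 20 rfl
    norm_num at h1
    linarith only [h0, h1]
  have r24_24 : M K 24 24 = M K 16 24 := by
    have h0 := M_comp G 24 24 16 rfl
    norm_num at h0
    have h1 := M_symm G 24 16
    norm_num at h1
    linarith only [h0, h1]
  have r24_28 : M K 24 28 = M K 12 24 := by
    have h0 := M_comp G 24 28 12 rfl
    norm_num at h0
    have h1 := M_symm G 24 12
    norm_num at h1
    linarith only [h0, h1]
  have r24_40 : M K 24 40 = M K 0 24 := by
    have h0 := M_comp G 24 40 0 rfl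
    norm_num at h0
    have h1 := M_symm G 24 0
    norm_num at h1
    linarith only [h0, h1]
  linarith

lemma euclWt_eq {n : ℕ} (w : Fin n → ZMod 4) :
    euclWt w = (oddS w).card + 4 * (Sset w 2).card := by
  have key : ∀ a : ZMod 4, (if a = 0 then 0 else if a = 2 then 4 else 1 : ℕ)
      = (if a = 1 ∨ a = 3 then 1 else 0) + 4 * (if a = 2 then 1 else 0) := by decide
  simp only [euclWt, oddS, Sset, Finset.card_filter, Finset.mul_sum, ← Finset.sum_add_distrib]
  exact Finset.sum_congr rfl fun i _ => key (w i)

lemma hWt_residue {n : ℕ} (c : Fin n → ZMod 4) :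
    hWt (fun i => ZMod.castHom (by norm_num : (2:ℕ) ∣ 4) (ZMod 2) (c i)) = (oddS c).card := by
  have key : ∀ a : ZMod 4, ZMod.castHom (by norm_num : (2:ℕ) ∣ 4) (ZMod 2) a ≠ 0 ↔
      (a = 1 ∨ a = 3) := by decide
  unfold hWt oddS
  congr 1
  ext i
  simp only [Finset.mem_filter, Finset.mem_univ, true_and]
  exact key (c i)

lemma zero_of_card {n : ℕ} (w : Fin n → ZMod 4) (h1 : (oddS w).card = 0)
    (h2 : (Sset w 2).card = 0) : w = 0 := by
  funext p
  have a1 : ¬ (w p = 1 ∨ w p = 3) := by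
    rw [← mem_oddS, Finset.card_eq_zero.1 h1]; simp
  have a2 : ¬ (w p = 2) := by
    rw [← mem_two, Finset.card_eq_zero.1 h2]; simp
  have key : ∀ a : ZMod 4, ¬ (a = 1 ∨ a = 3) → ¬ a = 2 → a = 0 := by decide
  exact key _ a1 a2

lemma smul_even {n : ℕ} {tu : Fin n → ZMod 4} (hev : IsEvenVec tu) (a : ZMod 4) :
    a • tu = 0 ∨ a • tu = tu := by
  have key : ∀ a : ZMod 4, (∀ b : ZMod 4, (b = 0 ∨ b = 2) → a * b = 0) ∨
      (∀ b : ZMod 4, (b = 0 ∨ b = 2) → a * b = b) := by decide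
  rcases key a with h | h
  · left; funext i; simpa using h _ (hev i)
  · right; funext i; simpa using h _ (hev i)

lemma inner_even {n : ℕ} {tu : Fin n → ZMod 4} (hev : IsEvenVec tu) (v : Fin n → ZMod 4) :
    z4Inner tu v = 2 * ((Sset tu 2 ∩ oddS v).card : ZMod 4) := by
  rw [card_inter, Finset.mul_sum]
  apply Finset.sum_congr rfl
  intro p _
  have key : ∀ a b : ZMod 4, (a = 0 ∨ a = 2) →
    a * b = 2 * (if a = 2 ∧ (b = 1 ∨ b = 3) then 1 else 0) := by decide
  exact key _ _ (hev p)

lemma inner_self_even {n : ℕ} {tu : Fin n → ZMod 4} (hev : IsEvenVec tu) :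
    z4Inner tu tu = 0 := by
  apply Finset.sum_eq_zero
  intro p _
  have key : ∀ a : ZMod 4, (a = 0 ∨ a = 2) → a * a = 0 := by decide
  exact key _ (hev p)

lemma oddS_add {n : ℕ} {tu : Fin n → ZMod 4} (hev : IsEvenVec tu) (v : Fin n → ZMod 4) :
    oddS (v + tu) = oddS v := by
  ext p
  simp only [mem_oddS, Pi.add_apply]
  have key : ∀ a b : ZMod 4, (b = 0 ∨ b = 2) → ((a + b = 1 ∨ a + b = 3) ↔ (a = 1 ∨ a = 3)) := by
    decide
  exact key _ _ (hev p)

lemma oddS_union {n : ℕ} (v : Fin n → ZMod 4) : Sset v 1 ∪ Sset v 3 = oddS v := by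
  ext p
  simp [Sset, mem_oddS]

lemma two_add {n : ℕ} {tu : Fin n → ZMod 4} (hev : IsEvenVec tu) (v : Fin n → ZMod 4) :
    (Sset (v + tu) 2).card = (Sset tu 2 \ (Sset v 1 ∪ Sset v 2 ∪ Sset v 3)).card +
        (Sset v 2 \ Sset tu 2).card := by
  rw [← Finset.card_union_of_disjoint]
  · congr 1
    ext p
    simp only [Sset, Finset.mem_filter, Finset.mem_univ, true_and, Finset.mem_union,
      Finset.mem_sdiff, Pi.add_apply]
    have key : ∀ a b : ZMod 4, (b = 0 ∨ b = 2) →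
      (a + b = 2 ↔ (b = 2 ∧ ¬ ((a = 1 ∨ a = 2) ∨ a = 3)) ∨ (a = 2 ∧ ¬ b = 2)) := by decide
    exact key _ _ (hev p)
  · rw [Finset.disjoint_left]
    intro p h1 h2
    exact (Finset.mem_sdiff.1 h2).2 (Finset.mem_sdiff.1 h1).1

lemma wt_add {n : ℕ} {tu : Fin n → ZMod 4} (hev : IsEvenVec tu) (v : Fin n → ZMod 4) :
    euclWt (v + tu) + 8 * (Finset.univ.filter fun p => tu p = 2 ∧ v p ≠ 0).card
      = euclWt v + 4 * (Sset tu 2).card + 4 * (Sset tu 2 ∩ oddS v).card := by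
  have e : Sset tu 2 ∩ oddS v = Finset.univ.filter fun p => tu p = 2 ∧ (v p = 1 ∨ v p = 3) := by
    ext p; simp [mem_oddS, mem_two]
  rw [e]
  simp only [euclWt, Sset, Finset.card_filter, Finset.mul_sum, ← Finset.sum_add_distrib]
  apply Finset.sum_congr rfl
  intro p _
  have key : ∀ a b : ZMod 4, (b = 0 ∨ b = 2) →
      (if a + b = 0 then 0 else if a + b = 2 then 4 else 1 : ℕ)
        + 8 * (if b = 2 ∧ a ≠ 0 then 1 else 0)
      = (if a = 0 then 0 else if a = 2 then 4 else 1 : ℕ) + 4 * (if b = 2 then 1 else 0)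
        + 4 * (if b = 2 ∧ (a = 1 ∨ a = 3) then 1 else 0) := by decide
  exact key _ _ (hev p)

/-- the doubled code as a submodule -/
def dbl {n : ℕ} (C : Submodule (ZMod 4) (Fin n → ZMod 4)) (tu : Fin n → ZMod 4) :
    Submodule (ZMod 4) (Fin n → ZMod 4) where
  carrier := doubled (C : Set (Fin n → ZMod 4)) tu
  add_mem' := by
    rintro x y ⟨v, hv, h0, a, rfl⟩ ⟨v', hv', h0', a', rfl⟩
    refine ⟨v + v', C.add_mem hv hv', ?_, a + a', ?_⟩
    · rw [z4Inner_add_right, h0, h0', add_zero]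
    · rw [add_smul]; abel
  zero_mem' := ⟨0, C.zero_mem, z4Inner_zero_right _, 0, by simp⟩
  smul_mem' := by
    rintro c x ⟨v, hv, h0, a, rfl⟩
    refine ⟨c • v, C.smul_mem c hv, ?_, c * a, ?_⟩
    · rw [z4Inner_smul_right, h0, mul_zero]
    · rw [smul_add, mul_smul]

lemma main {n : ℕ} (hn : n = 48 ∨ n = 56 ∨ n = 64)
    (C : Submodule (ZMod 4) (Fin n → ZMod 4))
    (hC : IsExtremalTypeIIZ4 n (C : Set (Fin n → ZMod 4)))
    (hres : IsExtremalTypeIIBin n (residueSet (C : Set (Fin n → ZMod 4))))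
    (tu : Fin n → ZMod 4) (hev : IsEvenVec tu)
    (hcard : Even (Sset tu 2).card)
    (hno : ∀ v ∈ C, ¬ (
      (Sset v 2 ⊆ Sset tu 2 ∧ Sset tu 2 ⊆ Sset v 1 ∪ Sset v 2 ∪ Sset v 3 ∧
        (Sset v 1 ∪ Sset v 3).card = 16) ∨
      ((Sset tu 2 \ (Sset v 1 ∪ Sset v 2 ∪ Sset v 3)).card +
        (Sset v 2 \ Sset tu 2).card = 1 ∧ (Sset v 1 ∪ Sset v 3).card = 12) ∨
      (((Sset tu 2 \ Sset v 2).card + (Sset v 2 \ Sset tu 2).card = 2 ∨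
        (Sset tu 2 \ Sset v 2).card + (Sset v 2 \ Sset tu 2).card = 4) ∧
        (Sset v 1 ∪ Sset v 3).card = 0))) :
    IsExtremalTypeIIZ4 n (doubled (C : Set (Fin n → ZMod 4)) tu) := by
  have e24 : 8 * (n / 24) + 8 = 24 := by rcases hn with rfl | rfl | rfl <;> rfl
  have e12 : 4 * (n / 24) + 4 = 12 := by rcases hn with rfl | rfl | rfl <;> rfl
  obtain ⟨⟨hsd, hdvd⟩, hmin⟩ := hC
  obtain ⟨⟨hbd, hb4⟩, hbmin⟩ := hres
  rw [e24] at hmin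
  rw [e12] at hbmin
  have corth : ∀ v ∈ C, ∀ w ∈ C, z4Inner v w = 0 := by
    intro v hv w hw
    have : v ∈ z4Dual (C : Set (Fin n → ZMod 4)) := by rw [← hsd]; exact hv
    exact this w hw
  have cdual : ∀ x, (∀ w ∈ C, z4Inner x w = 0) → x ∈ C := by
    intro x hx
    have : x ∈ z4Dual (C : Set (Fin n → ZMod 4)) := fun w hw => hx w hw
    rw [← hsd] at this
    exact this
  have c4 : ∀ v ∈ C, 4 ∣ (oddS v).card := by
    intro v hv
    have := hb4 _ ⟨v, hv, rfl⟩
    rwa [hWt_residue] at this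
  have c12 : ∀ v ∈ C, (oddS v).card = 0 ∨ 12 ≤ (oddS v).card := by
    intro v hv
    by_cases h : (oddS v).card = 0
    · exact Or.inl h
    right
    rw [← hbmin, ← hWt_residue]
    apply Nat.sInf_le
    refine ⟨_, ⟨⟨v, hv, rfl⟩, ?_⟩, rfl⟩
    intro h0
    apply h
    rw [← hWt_residue, Set.mem_singleton_iff.1 h0]
    simp [hWt]
  have c24 : ∀ v ∈ C, v ≠ 0 → 24 ≤ euclWt v := by
    intro v hv h
    rw [← hmin]
    exact Nat.sInf_le ⟨v, ⟨hv, h⟩, rfl⟩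
  have cones : ∃ o ∈ C, ∀ p, o p = 1 ∨ o p = 3 := by
    have h1 : (fun _ => 1 : Fin n → ZMod 2) ∈ residueSet (C : Set (Fin n → ZMod 4)) := by
      rw [hbd]
      intro y hy
      have h4 := hb4 y hy
      have key : ∀ a : ZMod 2, a = if a ≠ 0 then 1 else 0 := by decide
      have : bInner (fun _ => 1) y = (hWt y : ZMod 2) := by
        unfold bInner hWt
        rw [← Finset.sum_boole]
        apply Finset.sum_congr rfl
        intro i _
        rw [one_mul]
        exact key _
      rw [this, ZMod.natCast_eq_zero_iff]
      omega
    obtain ⟨o, ho, h⟩ := h1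
    refine ⟨o, ho, fun p => ?_⟩
    have hp := congrFun h p
    have key : ∀ a : ZMod 4, 1 = ZMod.castHom (by norm_num : (2:ℕ) ∣ 4) (ZMod 2) a →
      (a = 1 ∨ a = 3) := by decide
    exact key _ hp
  have hself := inner_self_even hev
  -- cases for members
  have kmem : ∀ w ∈ dbl C tu, ∃ v ∈ C, z4Inner tu v = 0 ∧ (w = v ∨ w = v + tu) := by
    rintro w ⟨v, hv, h0, a, rfl⟩
    refine ⟨v, hv, h0, ?_⟩
    rcases smul_even hev a with h | h <;> simp [h]
  have kodd : ∀ w ∈ dbl C tu, ∃ v ∈ C, oddS w = oddS v := by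
    intro w hw
    obtain ⟨v, hv, h0, rfl | rfl⟩ := kmem w hw
    · exact ⟨_, hv, rfl⟩
    · exact ⟨_, hv, oddS_add hev v⟩
  have kinc : ∀ v ∈ C, z4Inner tu v = 0 → v ∈ dbl C tu := fun v hv h0 =>
    ⟨v, hv, h0, 0, by simp⟩
  have ktu : tu ∈ dbl C tu := ⟨0, C.zero_mem, z4Inner_zero_right _, 1, by simp⟩
  have korth : ∀ v ∈ dbl C tu, ∀ w ∈ dbl C tu, z4Inner v w = 0 := by
    rintro x ⟨v, hv, h0, a, rfl⟩ y ⟨w, hw, h1, b, rfl⟩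
    simp only [z4Inner_add_left, z4Inner_add_right, z4Inner_smul_left, z4Inner_smul_right,
      corth v hv w hw, hself, h1, z4Inner_comm v tu, h0]
    simp
  have kdual : ∀ x, (∀ w ∈ dbl C tu, z4Inner x w = 0) → x ∈ dbl C tu := by
    intro x hx
    have hxt : z4Inner tu x = 0 := by rw [z4Inner_comm]; exact hx tu ktu
    rcases adj C hev x (fun w hw h0 => hx w (kinc w hw h0)) with h | h
    · exact kinc x (cdual x h) hxt
    · refine ⟨x - tu, cdual _ h, ?_, 1, by simp⟩
      rw [z4Inner_comm, z4Inner_sub_left, z4Inner_comm, hxt, hself, sub_zero]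
  have kdvd : ∀ w ∈ dbl C tu, 8 ∣ euclWt w := by
    intro w hw
    obtain ⟨v, hv, h0, rfl | rfl⟩ := kmem w hw
    · exact hdvd _ hv
    · have h1 := wt_add hev v
      have h2 := hdvd v hv
      rw [inner_even hev] at h0
      have h3 := two_mul_card h0
      obtain ⟨r, hr⟩ := h3
      obtain ⟨s, hs⟩ := hcard
      omega
  have kmin : ∀ w ∈ dbl C tu, w ≠ 0 → 24 ≤ euclWt w := by
    intro w hw hne
    have hd := kdvd w hw
    obtain ⟨v, hv, h0, rfl | rfl⟩ := kmem w hw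
    · exact c24 _ hv hne
    by_contra hlt
    push Not at hlt
    have hne' : ¬ ((oddS (v + tu)).card = 0 ∧ (Sset (v + tu) 2).card = 0) :=
      fun h => hne (zero_of_card _ h.1 h.2)
    rw [euclWt_eq] at hlt hd
    have h4 := c4 v hv
    have h12 := c12 v hv
    have hN := hno v hv
    have ht := two_add hev v
    rw [oddS_union] at hN
    rw [oddS_add hev] at hlt hd hne'
    have hcase : ((oddS v).card = 16 ∧ (Sset (v + tu) 2).card = 0) ∨
        ((oddS v).card = 12 ∧ (Sset (v + tu) 2).card = 1) ∨
        ((oddS v).card = 0 ∧ ((Sset (v + tu) 2).card = 2 ∨ (Sset (v + tu) 2).card = 4)) := by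
      omega
    apply hN
    rcases hcase with ⟨h, h'⟩ | ⟨h, h'⟩ | ⟨h, h'⟩
    · left
      rw [ht] at h'
      refine ⟨?_, ?_, h⟩
      · rw [← Finset.sdiff_eq_empty_iff_subset, ← Finset.card_eq_zero]; omega
      · rw [← Finset.sdiff_eq_empty_iff_subset, ← Finset.card_eq_zero]; omega
    · right; left
      exact ⟨by rw [← ht, h'], h⟩
    · right; right
      refine ⟨?_, h⟩
      have e : Sset v 1 ∪ Sset v 2 ∪ Sset v 3 = Sset v 2 := by
        have hu := oddS_union v
        rw [Finset.card_eq_zero.1 h, Finset.union_eq_empty] at hu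
        simp [hu.1, hu.2]
      rw [e] at ht
      rwa [← ht]
  have kex : ∃ w ∈ dbl C tu, w ≠ 0 ∧ euclWt w = 24 := by
    by_contra hcon
    push Not at hcon
    have G : Good (dbl C tu) := by
      refine ⟨korth, kdual, ?_, ?_, ?_, ?_, ?_⟩
      · obtain ⟨o, ho, h⟩ := cones
        refine ⟨o, kinc o ho ?_, h⟩
        rw [inner_even hev]
        have : Sset tu 2 ∩ oddS o = Sset tu 2 := by
          ext p
          simp [mem_oddS, h p]
        rw [this]
        obtain ⟨s, hs⟩ := hcard
        have e : (2 : ZMod 4) * ((Sset tu 2).card : ZMod 4) = ((4 * s : ℕ) : ZMod 4) := by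
          rw [hs]; push_cast; ring
        rw [e, ZMod.natCast_eq_zero_iff]
        exact dvd_mul_right _ _
      · intro w hw
        rw [← euclWt_eq]; exact kdvd w hw
      · intro w hw
        obtain ⟨v, hv, e⟩ := kodd w hw
        rw [e]; exact c4 v hv
      · intro w hw
        obtain ⟨v, hv, e⟩ := kodd w hw
        rw [e]; exact c12 v hv
      · intro w hw hne
        rw [← euclWt_eq]
        exact lt_of_le_of_ne (kmin w hw hne) (Ne.symm (hcon w hw hne))
    rcases hn with rfl | rfl | rfl
    · exact no_48 _ G
    · exact no_56 _ G
    · exact no_64 _ G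
  refine ⟨⟨?_, kdvd⟩, ?_⟩
  · apply Set.eq_of_subset_of_subset
    · exact fun x hx c hc => korth x hx c hc
    · exact fun x hx => kdual x hx
  · rw [e24]
    obtain ⟨w, hw, hne, h⟩ := kex
    apply le_antisymm
    · rw [← h]
      exact Nat.sInf_le ⟨w, ⟨hw, hne⟩, rfl⟩
    · refine le_csInf (Set.Nonempty.image _ ⟨w, hw, hne⟩) ?_
      rintro _ ⟨x, ⟨hx, hx0⟩, rfl⟩
      exact kmin x hx hx0

end DoublingAux

theorem stmt2 {n k : ℕ} (hn : n ∈ ({48, 56, 64} : Set ℕ)) (hkn : k ≤ n)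
    (C : Submodule (ZMod 4) (Fin n → ZMod 4))
    (hC : IsExtremalTypeIIZ4 n (C : Set (Fin n → ZMod 4)))
    (hfree : Module.Free (ZMod 4) C)
    (hrank : Module.finrank (ZMod 4) C = k)
    (hproj : Set.BijOn (fun (x : Fin n → ZMod 4) (j : Fin k) => x (Fin.castLE hkn j))
      (C : Set (Fin n → ZMod 4)) Set.univ)
    (hres : IsExtremalTypeIIBin n (residueSet (C : Set (Fin n → ZMod 4))))
    (tu : Fin n → ZMod 4) (hev : IsEvenVec tu)
    (hpos : ∀ i : Fin n, tu i = 2 → k ≤ (i : ℕ))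
    (hcard : Even (Sset tu 2).card) (hcard6 : 6 ≤ (Sset tu 2).card)
    (hno : ∀ v ∈ C, ¬ (
      (Sset v 2 ⊆ Sset tu 2 ∧ Sset tu 2 ⊆ Sset v 1 ∪ Sset v 2 ∪ Sset v 3 ∧
        (Sset v 1 ∪ Sset v 3).card = 16) ∨
      ((Sset tu 2 \ (Sset v 1 ∪ Sset v 2 ∪ Sset v 3)).card +
        (Sset v 2 \ Sset tu 2).card = 1 ∧ (Sset v 1 ∪ Sset v 3).card = 12) ∨
      (((Sset tu 2 \ Sset v 2).card + (Sset v 2 \ Sset tu 2).card = 2 ∨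
        (Sset tu 2 \ Sset v 2).card + (Sset v 2 \ Sset tu 2).card = 4) ∧
        (Sset v 1 ∪ Sset v 3).card = 0))) :
    IsExtremalTypeIIZ4 n (doubled (C : Set (Fin n → ZMod 4)) tu) := by
  have hn' : n = 48 ∨ n = 56 ∨ n = 64 := by simpa using hn
  exact DoublingAux.main hn' C hC hres tu hev hcard hno
end

section
/- Let n ∈ {48, 56, 64}, let C be an extremal Type II Z4-code of length n, and let 2u ∈ (ZMod 4)^n be an even vector with 2u ∉ C and with an even number of coordinates equal to 2. If the doubled code C̃ = {v ∈ C : ⟨2u, v⟩ = 0} + span{2u} is not extremal, then there exists v ∈ C with ⟨2u, v⟩ = 0 such that wt_E(v + 2u) ∈ {8, 16}. -/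
open Finset

lemma quad_pow_trunc (N : ℕ) : ∃ U : Polynomial ℂ, ∀ t : ℂ,
    (1 + 6 * t + t ^ 2) ^ N = 1 + 6 * N * t + (N + 18 * N * (N - 1)) * t ^ 2
      + (36 * N * (N - 1) * (N - 2) + 6 * N * (N - 1)) * t ^ 3 + t ^ 4 * U.eval t := by
  induction N with
  | zero => exact ⟨0, fun t => by simp⟩
  | succ k ih =>
    obtain ⟨U, hU⟩ := ih
    refine ⟨U * (1 + (6 : Polynomial ℂ) * Polynomial.X + Polynomial.X ^ 2)
      + Polynomial.C (((k : ℂ) + 18 * k * (k - 1)) + 6 * (36 * k * (k - 1) * (k - 2) + 6 * k * (k - 1)))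
      + Polynomial.C (36 * (k : ℂ) * (k - 1) * (k - 2) + 6 * k * (k - 1)) * Polynomial.X, fun t => ?_⟩
    rw [pow_succ, hU t]
    simp only [Polynomial.eval_add, Polynomial.eval_mul, Polynomial.eval_C, Polynomial.eval_X,
      Polynomial.eval_pow, Polynomial.eval_one, Polynomial.eval_ofNat]
    push_cast
    ring

lemma low_coeffs_zero (A0 A1 A2 A3 : ℂ) (H : Polynomial ℂ)
    (h : ∀ t : ℂ, A0 + A1 * t + A2 * t ^ 2 + A3 * t ^ 3 + t ^ 4 * H.eval t = 0) :
    A0 = 0 ∧ A1 = 0 ∧ A2 = 0 ∧ A3 = 0 := by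
  have hp : Polynomial.C A0 + Polynomial.C A1 * Polynomial.X ^ 1
      + Polynomial.C A2 * Polynomial.X ^ 2
      + Polynomial.C A3 * Polynomial.X ^ 3 + Polynomial.X ^ 4 * H = 0 := by
    apply Polynomial.funext
    intro t
    simpa using h t
  have h0 := congrArg (fun p => Polynomial.coeff p 0) hp
  have h1 := congrArg (fun p => Polynomial.coeff p 1) hp
  have h2 := congrArg (fun p => Polynomial.coeff p 2) hp
  have h3 := congrArg (fun p => Polynomial.coeff p 3) hp
  simp only [Polynomial.coeff_add, Polynomial.coeff_C_mul_X_pow, Polynomial.coeff_C,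
    Polynomial.coeff_X_pow_mul', Polynomial.coeff_zero] at h0 h1 h2 h3
  norm_num at h0 h1 h2 h3
  exact ⟨h0, h1, h2, h3⟩

/-- The first four coefficients of a form of even degree `m` restricted to the curve. -/
lemma form_low_coeffs (m K : ℕ) (hm : 6 ≤ m) (e : ℕ → ℂ) (G : Polynomial ℂ)
    (hG : ∀ t : ℂ, ∑ j ∈ range (4 + K), e j * (64 * t * (1 + t) ^ 2) ^ j
      * (1 + 6 * t + t ^ 2) ^ (m - 2 * j) = 1 + t ^ 4 * G.eval t) :
    e 0 = 1 ∧ e 0 * (6 * m) + 64 * e 1 = 0 ∧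
    e 0 * (m + 18 * m * (m - 1)) + 64 * e 1 * (6 * (m - 2) + 2) + 64 ^ 2 * e 2 = 0 ∧
    e 0 * (36 * m * (m - 1) * (m - 2) + 6 * m * (m - 1))
      + 64 * e 1 * (((m - 2) + 18 * (m - 2) * (m - 3)) + 2 * (6 * (m - 2)) + 1)
      + 64 ^ 2 * e 2 * (6 * (m - 4) + 4) + 64 ^ 3 * e 3 = 0 := by
  obtain ⟨U0, h0⟩ := quad_pow_trunc m
  obtain ⟨U1, h1⟩ := quad_pow_trunc (m - 2)
  obtain ⟨U2, h2⟩ := quad_pow_trunc (m - 4)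
  obtain ⟨U3, h3⟩ := quad_pow_trunc (m - 6)
  have c2 : ((m - 2 : ℕ) : ℂ) = m - 2 := by push_cast [show 2 ≤ m by omega]; ring
  have c4 : ((m - 4 : ℕ) : ℂ) = m - 4 := by push_cast [show 4 ≤ m by omega]; ring
  have c6 : ((m - 6 : ℕ) : ℂ) = m - 6 := by push_cast [show 6 ≤ m by omega]; ring
  rw [c2] at h1
  rw [c4] at h2
  rw [c6] at h3
  set T : Polynomial ℂ := ∑ j ∈ range K, Polynomial.C (e (4 + j) * 64 ^ (4 + j)) * Polynomial.X ^ j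
      * (1 + Polynomial.X) ^ (2 * (4 + j))
      * (1 + 6 * Polynomial.X + Polynomial.X ^ 2) ^ (m - 2 * (4 + j)) with hT
  have hTe : ∀ t : ℂ, ∑ j ∈ range K, e (4 + j) * (64 * t * (1 + t) ^ 2) ^ (4 + j)
      * (1 + 6 * t + t ^ 2) ^ (m - 2 * (4 + j)) = t ^ 4 * T.eval t := by
    intro t
    rw [hT, Polynomial.eval_finsetSum, mul_sum]
    refine sum_congr rfl fun j _ => ?_
    simp only [Polynomial.eval_add, Polynomial.eval_mul, Polynomial.eval_C, Polynomial.eval_X,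
      Polynomial.eval_pow, Polynomial.eval_one, Polynomial.eval_ofNat]
    rw [mul_pow, mul_pow, ← pow_mul, pow_add t]
    ring
  -- the tail coefficients in degree at least four
  obtain ⟨V, hV⟩ : ∃ V : Polynomial ℂ, ∀ t : ℂ,
      e 0 * (1 + 6 * t + t ^ 2) ^ m + e 1 * (64 * t * (1 + t) ^ 2) * (1 + 6 * t + t ^ 2) ^ (m - 2)
      + e 2 * (64 * t * (1 + t) ^ 2) ^ 2 * (1 + 6 * t + t ^ 2) ^ (m - 4)
      + e 3 * (64 * t * (1 + t) ^ 2) ^ 3 * (1 + 6 * t + t ^ 2) ^ (m - 6)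
      = e 0 + (e 0 * (6 * m) + 64 * e 1) * t +
    (e 0 * (m + 18 * m * (m - 1)) + 64 * e 1 * (6 * (m - 2) + 2) + 64 ^ 2 * e 2) * t ^ 2 +
    (e 0 * (36 * m * (m - 1) * (m - 2) + 6 * m * (m - 1))
      + 64 * e 1 * (((m - 2) + 18 * (m - 2) * (m - 3)) + 2 * (6 * (m - 2)) + 1)
      + 64 ^ 2 * e 2 * (6 * (m - 4) + 4) + 64 ^ 3 * e 3) * t ^ 3 + t ^ 4 * V.eval t := by
    let a1 : ℂ := 6 * (m - 2)
    let a2 : ℂ := (m - 2) + 18 * (m - 2) * (m - 2 - 1)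
    let a3 : ℂ := 36 * (m - 2) * (m - 2 - 1) * (m - 2 - 2) + 6 * (m - 2) * (m - 2 - 1)
    let b1 : ℂ := 6 * (m - 4)
    let b2 : ℂ := (m - 4) + 18 * (m - 4) * (m - 4 - 1)
    let b3 : ℂ := 36 * (m - 4) * (m - 4 - 1) * (m - 4 - 2) + 6 * (m - 4) * (m - 4 - 1)
    let d1 : ℂ := 6 * (m - 6)
    let d2 : ℂ := (m - 6) + 18 * (m - 6) * (m - 6 - 1)
    let d3 : ℂ := 36 * (m - 6) * (m - 6 - 1) * (m - 6 - 2) + 6 * (m - 6) * (m - 6 - 1)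
    let x : Polynomial ℂ := Polynomial.X
    refine ⟨Polynomial.C (e 0) * U0
      + Polynomial.C (64 * e 1) * (Polynomial.C (a1 + 2 * a2 + a3) + Polynomial.C (a2 + 2 * a3) * x
          + Polynomial.C a3 * x ^ 2 + x * (1 + x) ^ 2 * U1)
      + Polynomial.C (64 ^ 2 * e 2) * (
          (6 + 4 * x + x ^ 2) + Polynomial.C b1 * (4 + 6 * x + 4 * x ^ 2 + x ^ 3)
          + Polynomial.C b2 * (1 + x) ^ 4
          + Polynomial.C b3 * x * (1 + x) ^ 4 + x ^ 2 * (1 + x) ^ 4 * U2)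
      + Polynomial.C (64 ^ 3 * e 3) * (
          (6 + 15 * x + 20 * x ^ 2 + 15 * x ^ 3 + 6 * x ^ 4 + x ^ 5)
          + Polynomial.C d1 * (1 + x) ^ 6
          + Polynomial.C d2 * x * (1 + x) ^ 6
          + Polynomial.C d3 * x ^ 2 * (1 + x) ^ 6 + x ^ 3 * (1 + x) ^ 6 * U3), fun t => ?_⟩
    rw [h0 t, h1 t, h2 t, h3 t]
    simp only [Polynomial.eval_add, Polynomial.eval_mul, Polynomial.eval_C, Polynomial.eval_X,
      Polynomial.eval_pow, Polynomial.eval_one, Polynomial.eval_ofNat, x, a1, a2, a3, b1, b2, b3,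
      d1, d2, d3]
    ring
  have key : e 0 - 1 = 0 ∧ e 0 * (6 * m) + 64 * e 1 = 0 ∧
      e 0 * (m + 18 * m * (m - 1)) + 64 * e 1 * (6 * (m - 2) + 2) + 64 ^ 2 * e 2 = 0 ∧
      e 0 * (36 * m * (m - 1) * (m - 2) + 6 * m * (m - 1))
      + 64 * e 1 * (((m - 2) + 18 * (m - 2) * (m - 3)) + 2 * (6 * (m - 2)) + 1)
      + 64 ^ 2 * e 2 * (6 * (m - 4) + 4) + 64 ^ 3 * e 3 = 0 := low_coeffs_zero _ _ _ _ (V + T - G) (fun t => by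
    have h := hG t
    rw [sum_range_add, hTe t, sum_range_succ, sum_range_succ, sum_range_succ, sum_range_succ,
      sum_range_zero] at h
    have hv := hV t
    simp only [mul_zero, tsub_zero, pow_zero, mul_one, pow_one, zero_add, Nat.reduceMul] at h
    rw [hv] at h
    rw [Polynomial.eval_sub, Polynomial.eval_add]
    linear_combination h)
  exact ⟨by linear_combination key.1, key.2⟩

lemma no_form_12 (e : ℕ → ℂ) (G : Polynomial ℂ)
    (hS : ∀ y u : ℂ, ∑ j ∈ range 7, e j * y ^ (2 * j) * u ^ (12 - 2 * j)
      = ∑ j ∈ range 7, e j * (u - y / 2) ^ (2 * j) * (u / 2 + 3 * y / 4) ^ (12 - 2 * j))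
    (hG : ∀ t : ℂ, ∑ j ∈ range 7, e j * (64 * t * (1 + t) ^ 2) ^ j
      * (1 + 6 * t + t ^ 2) ^ (12 - 2 * j) = 1 + t ^ 4 * G.eval t) : False := by
  obtain ⟨h0, h1, h2, h3⟩ := form_low_coeffs 12 3 (by norm_num) e G hG
  have s0 := hS 2 0
  have s1 := hS 4 1
  have s2 := hS 4 3
  have s3 := hS 2 1
  simp only [sum_range_succ, sum_range_zero] at s0 s1 s2 s3
  norm_num at s0 s1 s2 s3 h1 h2 h3
  have : (1 : ℂ) = 0 := by
    linear_combination (-1) * h0 + (-12223/818928) * h1 + (1/68244) * h2 + (1/818928) * h3 + (126322688/16803020619) * s0 + (-209152/76408797465) * s1 + (-48896/285651350523) * s2 + (31589/7184232) * s3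
  exact one_ne_zero this

lemma no_form_14 (e : ℕ → ℂ) (G : Polynomial ℂ)
    (hS : ∀ y u : ℂ, ∑ j ∈ range 8, e j * y ^ (2 * j) * u ^ (14 - 2 * j)
      = ∑ j ∈ range 8, e j * (u - y / 2) ^ (2 * j) * (u / 2 + 3 * y / 4) ^ (14 - 2 * j))
    (hG : ∀ t : ℂ, ∑ j ∈ range 8, e j * (64 * t * (1 + t) ^ 2) ^ j
      * (1 + 6 * t + t ^ 2) ^ (14 - 2 * j) = 1 + t ^ 4 * G.eval t) : False := by
  obtain ⟨h0, h1, h2, h3⟩ := form_low_coeffs 14 4 (by norm_num) e G hG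
  have s0 := hS 2 0
  have s1 := hS 4 1
  have s2 := hS 4 3
  have s3 := hS 2 1
  have s4 := hS 4 5
  simp only [sum_range_succ, sum_range_zero] at s0 s1 s2 s3 s4
  norm_num at s0 s1 s2 s3 s4 h1 h2 h3
  have : (1 : ℂ) = 0 := by
    linear_combination (-1) * h0 + (-1053/27104) * h1 + (-1/5082) * h2 + (1/243936) * h3 + (-15486207881728/1841011580452275) * s0 + (1620019256/2002177577394225) * s1 + (58924784/672501750875955) * s2 + (-395367306641/63474608026368) * s3 + (-383212616/117892926763036425) * s4
  exact one_ne_zero this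

lemma no_form_16 (e : ℕ → ℂ) (G : Polynomial ℂ)
    (hS : ∀ y u : ℂ, ∑ j ∈ range 9, e j * y ^ (2 * j) * u ^ (16 - 2 * j)
      = ∑ j ∈ range 9, e j * (u - y / 2) ^ (2 * j) * (u / 2 + 3 * y / 4) ^ (16 - 2 * j))
    (hG : ∀ t : ℂ, ∑ j ∈ range 9, e j * (64 * t * (1 + t) ^ 2) ^ j
      * (1 + 6 * t + t ^ 2) ^ (16 - 2 * j) = 1 + t ^ 4 * G.eval t) : False := by
  obtain ⟨h0, h1, h2, h3⟩ := form_low_coeffs 16 5 (by norm_num) e G hG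
  have s0 := hS 2 0
  have s1 := hS 4 1
  have s2 := hS 4 3
  have s3 := hS 2 1
  have s4 := hS 4 5
  have s5 := hS 6 1
  simp only [sum_range_succ, sum_range_zero] at s0 s1 s2 s3 s4 s5
  norm_num at s0 s1 s2 s3 s4 s5 h1 h2 h3
  have : (1 : ℂ) = 0 := by
    linear_combination (-1) * h0 + (-101/1344) * h1 + (-9/3472) * h2 + (1/41664) * h3 + (261705917696/733437676125) * s0 + (850690634/125417842617375) * s1 + (131764/3155115530385) * s2 + (-205307182445/6554532483072) * s3 + (-20979514/148369307816354625) * s4 + (-287087620067/15992649600415488000) * s5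
  exact one_ne_zero this

/-- The local weight: `a` at `0`, `b` at `±1`, `c` at `2`. -/
def locWt (a b c : ℂ) (x : ZMod 4) : ℂ := if x = 0 then a else if x = 2 then c else b

/-- The symmetrized weight enumerator. -/
noncomputable def swe {n : ℕ} (D : Finset (Fin n → ZMod 4)) (a b c : ℂ) : ℂ :=
  ∑ v ∈ D, ∏ i, locWt a b c (v i)

noncomputable def chi4 : AddChar (ZMod 4) ℂ := AddChar.zmodChar 4 Complex.I_pow_four

lemma map_sum_chi4 {n : ℕ} (g : Fin n → ZMod 4) : chi4 (∑ i, g i) = ∏ i, chi4 (g i) := by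
  classical
  have : ∀ s : Finset (Fin n), chi4 (∑ i ∈ s, g i) = ∏ i ∈ s, chi4 (g i) := by
    intro s
    induction s using Finset.induction_on with
    | empty => simp
    | insert a s ha ih => rw [sum_insert ha, prod_insert ha, AddChar.map_add_eq_mul, ih]
  exact this univ

lemma chi4_transform (a b c : ℂ) (y : ZMod 4) :
    ∑ x, chi4 (y * x) * locWt a b c x
      = locWt (a + 2 * b + c) (a - c) (a - 2 * b + c) y := by
  have h0 : chi4 0 = 1 := AddChar.map_zero_eq_one _
  have h1 : chi4 1 = Complex.I := by
    rw [chi4, AddChar.zmodChar_apply]; simp [ZMod.val_one'']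
  have h2 : chi4 2 = -1 := by
    have : (2 : ZMod 4) = 1 + 1 := by decide
    rw [this, AddChar.map_add_eq_mul, h1, Complex.I_mul_I]
  have h3 : chi4 3 = -Complex.I := by
    have : (3 : ZMod 4) = 2 + 1 := by decide
    rw [this, AddChar.map_add_eq_mul, h1, h2]; ring
  have hs : ∀ f : ZMod 4 → ℂ, ∑ x, f x = f 0 + f 1 + f 2 + f 3 := fun f => Fin.sum_univ_four f
  rw [hs]
  have hy : y = 0 ∨ y = 1 ∨ y = 2 ∨ y = 3 := by revert y; decide
  have e10 : (1 : ZMod 4) ≠ 0 := by decide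
  have e12 : (1 : ZMod 4) ≠ 2 := by decide
  have e20 : (2 : ZMod 4) ≠ 0 := by decide
  have e30 : (3 : ZMod 4) ≠ 0 := by decide
  have e32 : (3 : ZMod 4) ≠ 2 := by decide
  have m22 : (2 * 2 : ZMod 4) = 0 := by decide
  have m23 : (2 * 3 : ZMod 4) = 2 := by decide
  have m32 : (3 * 2 : ZMod 4) = 2 := by decide
  have m33 : (3 * 3 : ZMod 4) = 1 := by decide
  rcases hy with rfl | rfl | rfl | rfl <;>
    simp only [locWt, e10, e12, e20, e30, e32, m22, m23, m32, m33, mul_zero, zero_mul, mul_one,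
      one_mul, if_true, if_false, h0, h1, h2, h3] <;> ring

lemma z4Inner_add_left {n : ℕ} (x y z : Fin n → ZMod 4) :
    z4Inner (x + y) z = z4Inner x z + z4Inner y z := by
  simp [z4Inner, add_mul, sum_add_distrib]

lemma z4Inner_smul_left {n : ℕ} (a : ZMod 4) (y z : Fin n → ZMod 4) :
    z4Inner (a • y) z = a * z4Inner y z := by
  simp [z4Inner, mul_sum, mul_assoc]

lemma z4Inner_comm {n : ℕ} (x y : Fin n → ZMod 4) : z4Inner x y = z4Inner y x := by
  simp [z4Inner, mul_comm]

lemma z4Inner_add_right {n : ℕ} (x y z : Fin n → ZMod 4) :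
    z4Inner x (y + z) = z4Inner x y + z4Inner x z := by
  rw [z4Inner_comm, z4Inner_add_left, z4Inner_comm y, z4Inner_comm z]

lemma z4Inner_smul_right {n : ℕ} (a : ZMod 4) (y z : Fin n → ZMod 4) :
    z4Inner y (a • z) = a * z4Inner y z := by
  rw [z4Inner_comm, z4Inner_smul_left, z4Inner_comm]

/-- Orthogonality of characters on a subset closed under addition by its own elements. -/
lemma sum_chi4 {n : ℕ} (D : Finset (Fin n → ZMod 4))
    (hD : IsSelfDualZ4 (D : Set (Fin n → ZMod 4))) (x : Fin n → ZMod 4) :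
    ∑ v ∈ D, chi4 (z4Inner v x) = if x ∈ D then (D.card : ℂ) else 0 := by
  have hmem : ∀ y, y ∈ D ↔ ∀ c ∈ D, z4Inner y c = 0 := by
    intro y
    have : y ∈ (D : Set (Fin n → ZMod 4)) ↔ y ∈ z4Dual (D : Set (Fin n → ZMod 4)) := by
      rw [← hD]
    simpa [z4Dual] using this
  split_ifs with hx
  · have : ∀ v ∈ D, chi4 (z4Inner v x) = 1 := by
      intro v hv
      rw [(hmem v).1 hv x hx, AddChar.map_zero_eq_one]
    rw [sum_congr rfl this]; simp
  · rw [hmem] at hx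
    push Not at hx
    obtain ⟨c, hc, hxc⟩ := hx
    have hcx : z4Inner c x ≠ 0 := by rwa [z4Inner_comm]
    have hne : chi4 (z4Inner c x) ≠ 1 := by
      have hp := AddChar.zmodChar_primitive_of_primitive_root 4 Complex.isPrimitiveRoot_I
      intro h
      exact hcx ((AddChar.IsPrimitive.zmod_char_eq_one_iff 4 hp _).1 h)
    have hadd : ∀ v, v ∈ D → v + c ∈ D := by
      intro v hv
      rw [hmem]
      intro d hd
      rw [z4Inner_add_left, (hmem v).1 hv d hd, (hmem c).1 hc d hd, add_zero]
    have hsub : ∀ v, v ∈ D → v - c ∈ D := by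
      intro v hv
      rw [hmem]
      intro d hd
      have := z4Inner_add_left (v - c) c d
      rw [sub_add_cancel, (hmem v).1 hv d hd, (hmem c).1 hc d hd, add_zero] at this
      exact this.symm
    have key : ∑ v ∈ D, chi4 (z4Inner v x) = ∑ v ∈ D, chi4 (z4Inner (v + c) x) := by
      symm
      refine sum_nbij' (fun v => v + c) (fun v => v - c) hadd hsub ?_ ?_ ?_
      · intro v _; simp
      · intro v _; simp
      · intro v _; rfl
    have key2 : ∑ v ∈ D, chi4 (z4Inner (v + c) x)
        = (∑ v ∈ D, chi4 (z4Inner v x)) * chi4 (z4Inner c x) := by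
      rw [sum_mul]
      refine sum_congr rfl fun v _ => ?_
      rw [z4Inner_add_left, AddChar.map_add_eq_mul]
    rw [key2] at key
    have : (∑ v ∈ D, chi4 (z4Inner v x)) * (chi4 (z4Inner c x) - 1) = 0 := by
      linear_combination -key
    exact (mul_eq_zero.1 this).resolve_right (sub_ne_zero.2 hne)

lemma macWilliams_aux {n : ℕ} (D : Finset (Fin n → ZMod 4))
    (hD : IsSelfDualZ4 (D : Set (Fin n → ZMod 4))) (a b c : ℂ) :
    swe D (a + 2 * b + c) (a - c) (a - 2 * b + c) = D.card * swe D a b c := by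
  have h1 : ∀ v : Fin n → ZMod 4,
      ∏ i, locWt (a + 2 * b + c) (a - c) (a - 2 * b + c) (v i)
        = ∑ x : Fin n → ZMod 4, chi4 (z4Inner v x) * ∏ i, locWt a b c (x i) := by
    intro v
    simp_rw [← chi4_transform]
    rw [Finset.prod_univ_sum, Fintype.piFinset_univ]
    refine sum_congr rfl fun x _ => ?_
    rw [prod_mul_distrib, z4Inner]
    congr 1
    exact (map_sum_chi4 _).symm
  unfold swe
  simp_rw [h1]
  rw [sum_comm]
  simp_rw [← sum_mul, sum_chi4 D hD]
  simp only [ite_mul, zero_mul]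
  rw [← sum_filter, mul_sum]
  refine sum_congr ?_ fun _ _ => rfl
  ext x; simp

lemma swe_smul {n : ℕ} (D : Finset (Fin n → ZMod 4)) (s a b c : ℂ) :
    swe D (s * a) (s * b) (s * c) = s ^ n * swe D a b c := by
  unfold swe
  rw [mul_sum]
  refine sum_congr rfl fun v _ => ?_
  have : ∀ x, locWt (s * a) (s * b) (s * c) x = s * locWt a b c x := by
    intro x; unfold locWt; split_ifs <;> rfl
  simp_rw [this]
  rw [prod_mul_distrib]
  simp

lemma macWilliams {n : ℕ} (D : Finset (Fin n → ZMod 4))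
    (hD : IsSelfDualZ4 (D : Set (Fin n → ZMod 4))) (a b c : ℂ) :
    swe D ((a + 2 * b + c) / 2) ((a - c) / 2) ((a - 2 * b + c) / 2) = swe D a b c := by
  have hmem : ∀ y, y ∈ D ↔ ∀ c ∈ D, z4Inner y c = 0 := by
    intro y
    have : y ∈ (D : Set (Fin n → ZMod 4)) ↔ y ∈ z4Dual (D : Set (Fin n → ZMod 4)) := by
      rw [← hD]
    simpa [z4Dual] using this
  have h0 : (0 : Fin n → ZMod 4) ∈ D := by rw [hmem]; intro c _; simp [z4Inner]
  have hz : swe D 1 0 0 = 1 := by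
    unfold swe
    rw [sum_eq_single_of_mem 0 h0]
    · simp [locWt]
    · intro v _ hv
      obtain ⟨i, hi⟩ := Function.ne_iff.1 hv
      refine prod_eq_zero (mem_univ i) ?_
      have : v i ≠ 0 := hi
      simp [locWt, this]
  have h2 : ∀ a b c : ℂ,
      2 ^ n * swe D ((a + 2 * b + c) / 2) ((a - c) / 2) ((a - 2 * b + c) / 2)
        = D.card * swe D a b c := by
    intro a b c
    rw [← macWilliams_aux D hD, ← swe_smul]
    congr 1 <;> ring
  have hcard : (D.card : ℂ) = 2 ^ n := by
    have e1 := h2 1 0 0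
    have e2 := h2 ((1 + 2 * 0 + 0) / 2) ((1 - 0) / 2) ((1 - 2 * 0 + 0) / 2)
    have e3 : swe D
        (((1 + 2 * 0 + 0) / 2 + 2 * ((1 - 0) / 2) + ((1 - 2 * 0 + 0) / 2)) / 2)
        (((1 + 2 * 0 + 0) / 2 - ((1 - 2 * 0 + 0) / 2)) / 2)
        (((1 + 2 * 0 + 0) / 2 - 2 * ((1 - 0) / 2) + ((1 - 2 * 0 + 0) / 2)) / 2) = 1 := by
      refine Eq.trans ?_ hz
      norm_num
    rw [e3] at e2
    rw [hz] at e1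
    have e4 : ((D.card : ℂ)) ^ 2 = (2 ^ n) ^ 2 := by
      linear_combination (2 : ℂ) ^ n * (-e2) - (D.card : ℂ) * e1
    have e5 : (D.card) ^ 2 = (2 ^ n) ^ 2 := by exact_mod_cast e4
    have e6 : D.card = 2 ^ n := by
      exact (Nat.pow_left_injective (n := 2) (by norm_num)) e5
    exact_mod_cast e6
  have := h2 a b c
  rw [hcard] at this
  exact mul_left_cancel₀ (pow_ne_zero n two_ne_zero) this

/-- Invariance coming from the divisibility of the Euclidean weights. -/
lemma swe_twist {n : ℕ} (D : Finset (Fin n → ZMod 4)) (hD : ∀ v ∈ D, 8 ∣ euclWt v)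
    (ζ : ℂ) (hζ : ζ ^ 4 = -1) (a b c : ℂ) : swe D a (ζ * b) (-c) = swe D a b c := by
  unfold swe
  refine sum_congr rfl fun v hv => ?_
  have h1 : ∀ x : ZMod 4, locWt a (ζ * b) (-c) x
      = ζ ^ (if x = 0 then 0 else if x = 2 then 4 else 1) * locWt a b c x := by
    intro x; unfold locWt; split_ifs <;> simp [hζ]
  simp_rw [h1]
  rw [prod_mul_distrib, prod_pow_eq_pow_sum]
  obtain ⟨k, hk⟩ := hD v hv
  have : ∑ i, (if v i = 0 then 0 else if v i = 2 then 4 else 1) = 8 * k := hk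
  rw [this, pow_mul, show ζ ^ 8 = 1 by rw [show 8 = 4 * 2 from rfl, pow_mul, hζ]; norm_num]
  simp

/-- A polynomial function invariant under `x ↦ i x` only involves fourth powers. -/
lemma keep_fourth {ι : Type*} (s : Finset ι) (k : ι → ℂ) (ex : ι → ℕ) (f : ℂ → ℂ)
    (hf : ∀ x, f x = ∑ d ∈ s, k d * x ^ ex d) (hI : ∀ x, f (Complex.I * x) = f x) (x : ℂ) :
    f x = ∑ d ∈ s with 4 ∣ ex d, k d * x ^ ex d := by
  have h1 : f x = (f x + f (Complex.I * x) + f (Complex.I * (Complex.I * x))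
      + f (Complex.I * (Complex.I * (Complex.I * x)))) / 4 := by
    simp only [hI]; ring
  rw [h1, hf, hf, hf, hf, ← sum_add_distrib, ← sum_add_distrib, ← sum_add_distrib, sum_div,
    sum_filter]
  refine sum_congr rfl fun d _ => ?_
  simp only [mul_pow]
  have hI4 : ∀ q, Complex.I ^ (4 * q) = 1 := fun q => by rw [pow_mul, Complex.I_pow_four, one_pow]
  have hI2 : Complex.I ^ 2 = -1 := Complex.I_sq
  have hI3 : Complex.I ^ 3 = -Complex.I := Complex.I_pow_three
  obtain ⟨q, r, hr, hqr⟩ : ∃ q r, r < 4 ∧ ex d = 4 * q + r :=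
    ⟨ex d / 4, ex d % 4, Nat.mod_lt _ (by norm_num), (Nat.div_add_mod _ _).symm⟩
  have hII : Complex.I ^ (ex d) = Complex.I ^ r := by rw [hqr, pow_add, hI4, one_mul]
  rw [hII]
  split_ifs with h
  · have : r = 0 := by omega
    subst this
    ring
  · have : r = 1 ∨ r = 2 ∨ r = 3 := by omega
    rcases this with rfl | rfl | rfl
    · rw [pow_one]
      linear_combination (k d * x ^ ex d / 4) * (1 + Complex.I) * hI2
    · rw [hI2]; ring
    · rw [hI3]
      linear_combination (k d * x ^ ex d / 4) * (1 - Complex.I) * hI2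

/-- Binary forms of degree `m`, as functions. -/
def IsForm (m : ℕ) (f : ℂ → ℂ → ℂ) : Prop :=
  ∃ g : ℕ → ℂ, ∀ y u, f y u = ∑ l ∈ range (m + 1), g l * y ^ l * u ^ (m - l)

lemma isForm_mul_lin {m : ℕ} {f : ℂ → ℂ → ℂ} (hf : IsForm m f) (α β : ℂ) :
    IsForm (m + 1) (fun y u => f y u * (α * u + β * y)) := by
  obtain ⟨g, hg⟩ := hf
  refine ⟨fun l => (if l < m + 1 then α * g l else 0) + (if l = 0 then 0 else β * g (l - 1)),
    fun y u => ?_⟩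
  simp only [add_mul, sum_add_distrib]
  rw [sum_range_succ, sum_range_succ' (fun l => (if l = 0 then 0 else β * g (l - 1)) * y ^ l
    * u ^ (m + 1 - l))]
  simp only [lt_irrefl, if_false, if_true, zero_mul, add_zero, Nat.add_eq_zero_iff, one_ne_zero,
    and_false, Nat.add_sub_cancel, Nat.add_sub_add_right]
  rw [hg, mul_add, sum_mul, sum_mul]
  congr 1
  · refine sum_congr rfl fun l hl => ?_
    have hl' : l < m + 1 := mem_range.1 hl
    rw [if_pos hl', show m + 1 - l = (m - l) + 1 by omega, pow_succ]
    ring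
  · refine sum_congr rfl fun l hl => ?_
    rw [pow_succ]
    ring

lemma isForm_mul_lin_pow {m : ℕ} {f : ℂ → ℂ → ℂ} (hf : IsForm m f) (α β : ℂ) (i : ℕ) :
    IsForm (m + i) (fun y u => f y u * (α * u + β * y) ^ i) := by
  induction i with
  | zero => simpa using hf
  | succ i ih =>
    have := isForm_mul_lin ih α β
    simpa only [pow_succ, mul_assoc, ← add_assoc] using this

lemma isForm_const (k : ℂ) : IsForm 0 (fun _ _ => k) := ⟨fun _ => k, fun y u => by simp⟩

lemma isForm_sum {ι : Type*} (s : Finset ι) (m : ℕ) (F : ι → ℂ → ℂ → ℂ)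
    (h : ∀ d ∈ s, IsForm m (F d)) : IsForm m (fun y u => ∑ d ∈ s, F d y u) := by
  choose! g hg using h
  refine ⟨fun l => ∑ d ∈ s, g d l, fun y u => ?_⟩
  simp only [sum_mul]
  rw [sum_congr rfl fun d hd => hg d hd y u, sum_comm]

lemma sum_range_even (h : ℕ) (F : ℕ → ℂ) (hF : ∀ l, F (2 * l + 1) = 0) :
    ∑ l ∈ range (2 * h + 1), F l = ∑ j ∈ range (h + 1), F (2 * j) := by
  induction h with
  | zero => simp
  | succ h ih =>
    rw [sum_range_succ _ (h + 1), ← ih, show 2 * (h + 1) + 1 = (2 * h + 1) + 1 + 1 by ring,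
      sum_range_succ, sum_range_succ, hF, add_zero]
    rfl

lemma isForm_even {h : ℕ} {f : ℂ → ℂ → ℂ} (hf : IsForm (2 * h) f)
    (hev : ∀ y u, f (-y) u = f y u) :
    ∃ e : ℕ → ℂ, ∀ y u, f y u = ∑ j ∈ range (h + 1), e j * y ^ (2 * j) * u ^ (2 * h - 2 * j) := by
  obtain ⟨g, hg⟩ := hf
  refine ⟨fun j => g (2 * j), fun y u => ?_⟩
  have h1 : f y u = (f y u + f (-y) u) / 2 := by rw [hev]; ring
  rw [h1, hg, hg, ← sum_add_distrib, sum_div, sum_range_even]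
  · refine sum_congr rfl fun j _ => ?_
    rw [Even.neg_pow (even_two_mul j)]
    ring
  · intro l
    rw [Odd.neg_pow (odd_two_mul_add_one l)]
    ring

/-- Polynomial version of the local weight in the coordinates `X = a + c`, `Y = 2b`, `Z = a - c`. -/
noncomputable def locPoly (x : ZMod 4) : MvPolynomial (Fin 3) ℂ :=
  if x = 0 then MvPolynomial.C (1 / 2) * (MvPolynomial.X 0 + MvPolynomial.X 2)
  else if x = 2 then MvPolynomial.C (1 / 2) * (MvPolynomial.X 0 + MvPolynomial.C (-1) *
    MvPolynomial.X 2)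
  else MvPolynomial.C (1 / 2) * MvPolynomial.X 1

lemma locPoly_hom (x : ZMod 4) : (locPoly x).IsHomogeneous 1 := by
  have hX : ∀ i : Fin 3, (MvPolynomial.X i : MvPolynomial (Fin 3) ℂ).IsHomogeneous 1 :=
    fun i => MvPolynomial.isHomogeneous_X _ _
  unfold locPoly
  split_ifs
  · exact MvPolynomial.IsHomogeneous.C_mul ((hX 0).add (hX 2)) _
  · exact MvPolynomial.IsHomogeneous.C_mul ((hX 0).add
      (MvPolynomial.IsHomogeneous.C_mul (hX 2) _)) _
  · exact MvPolynomial.IsHomogeneous.C_mul (hX 1) _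

lemma locPoly_eval (X Y Z : ℂ) (x : ZMod 4) :
    MvPolynomial.eval ![X, Y, Z] (locPoly x) = locWt ((X + Z) / 2) (Y / 2) ((X - Z) / 2) x := by
  unfold locPoly locWt
  split_ifs <;> simp <;> ring

lemma swe_expand {n : ℕ} (D : Finset (Fin n → ZMod 4)) :
    ∃ (s : Finset (Fin 3 →₀ ℕ)) (k : (Fin 3 →₀ ℕ) → ℂ),
      (∀ d ∈ s, d 0 + d 1 + d 2 = n) ∧
      ∀ X Y Z : ℂ, swe D ((X + Z) / 2) (Y / 2) ((X - Z) / 2)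
        = ∑ d ∈ s, k d * (X ^ d 0 * Y ^ d 1 * Z ^ d 2) := by
  set P : MvPolynomial (Fin 3) ℂ := ∑ v ∈ D, ∏ i, locPoly (v i) with hP
  have hhom : P.IsHomogeneous n := by
    refine MvPolynomial.IsHomogeneous.sum _ _ _ fun v _ => ?_
    have := MvPolynomial.IsHomogeneous.prod univ (fun i => locPoly (v i)) (fun _ => 1)
      (fun i _ => locPoly_hom (v i))
    simpa using this
  refine ⟨P.support, P.coeff, fun d hd => ?_, fun X Y Z => ?_⟩
  · have := hhom (MvPolynomial.mem_support_iff.1 hd)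
    rw [Finsupp.weight_apply, Finsupp.sum_fintype _ _ (by simp)] at this
    simpa [Fin.sum_univ_three] using this
  · have h1 : MvPolynomial.eval ![X, Y, Z] P = swe D ((X + Z) / 2) (Y / 2) ((X - Z) / 2) := by
      rw [hP, map_sum, swe]
      refine sum_congr rfl fun v _ => ?_
      rw [map_prod]
      exact prod_congr rfl fun i _ => locPoly_eval X Y Z _
    rw [← h1, MvPolynomial.eval_eq']
    refine sum_congr rfl fun d _ => ?_
    rw [Fin.prod_univ_three]
    rfl

/-- Gleason-type reduction: the weight enumerator restricted to the Fermat curve is given by a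
binary form of degree `n / 4`, even in the first variable and invariant under a further
substitution. -/
lemma exists_form {h : ℕ} (D : Finset (Fin (8 * h) → ZMod 4))
    (hD : IsTypeIIZ4 (D : Set (Fin (8 * h) → ZMod 4))) :
    ∃ e : ℕ → ℂ,
      (∀ y u : ℂ, ∑ j ∈ range (h + 1), e j * y ^ (2 * j) * u ^ (2 * h - 2 * j)
        = ∑ j ∈ range (h + 1), e j * (u - y / 2) ^ (2 * j)
          * (u / 2 + 3 * y / 4) ^ (2 * h - 2 * j)) ∧
      ∀ X Y Z y u : ℂ, X ^ 4 = u + y / 2 → Y ^ 4 = y → Z ^ 4 = u - y / 2 →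
        ∑ j ∈ range (h + 1), e j * y ^ (2 * j) * u ^ (2 * h - 2 * j)
          = swe D ((X + Z) / 2) (Y / 2) ((X - Z) / 2) := by
  obtain ⟨hsd, hwt⟩ := hD
  have hwt' : ∀ v ∈ D, 8 ∣ euclWt v := fun v hv => hwt v (by simpa using hv)
  obtain ⟨ζ, hζ⟩ : ∃ ζ : ℂ, ζ ^ 4 = -1 := IsAlgClosed.exists_pow_nat_eq (-1) (by norm_num)
  set Q : ℂ → ℂ → ℂ → ℂ := fun X Y Z => swe D ((X + Z) / 2) (Y / 2) ((X - Z) / 2) with hQ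
  have hS : ∀ X Y Z, Q X Z Y = Q X Y Z := by
    intro X Y Z
    rw [hQ]
    simp only
    rw [← macWilliams D hsd ((X + Z) / 2) (Y / 2) ((X - Z) / 2)]
    congr 1 <;> ring
  have hTw : ∀ (w : ℂ), w ^ 4 = -1 → ∀ X Y Z, Q Z (w * Y) X = Q X Y Z := by
    intro w hw X Y Z
    rw [hQ]
    simp only
    rw [← swe_twist D hwt' w hw ((X + Z) / 2) (Y / 2) ((X - Z) / 2)]
    congr 1 <;> ring
  have hIY : ∀ X Y Z, Q X (Complex.I * Y) Z = Q X Y Z := by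
    intro X Y Z
    have hζ0 : ζ ≠ 0 := by
      rintro rfl
      norm_num at hζ
    have hw : (Complex.I / ζ) ^ 4 = -1 := by
      rw [div_pow, Complex.I_pow_four, hζ]; norm_num
    have h1 := hTw ζ hζ Z (Complex.I / ζ * Y) X
    rw [← hTw _ hw X Y Z, ← h1]
    congr 1
    field_simp
  have hIZ : ∀ X Y Z, Q X Y (Complex.I * Z) = Q X Y Z := by
    intro X Y Z
    rw [hS, hIY, hS]
  have hIX : ∀ X Y Z, Q (Complex.I * X) Y Z = Q X Y Z := by
    intro X Y Z
    rw [← hTw ζ hζ, hIZ, hTw ζ hζ]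
  obtain ⟨s, k, hsum, hexp⟩ := swe_expand D
  have e1 : ∀ X Y Z, Q X Y Z = ∑ d ∈ s with 4 ∣ d 0, k d * (X ^ d 0 * Y ^ d 1 * Z ^ d 2) := by
    intro X Y Z
    have := keep_fourth s (fun d => k d * (Y ^ d 1 * Z ^ d 2)) (fun d => d 0) (fun X => Q X Y Z)
      (fun X => by
        rw [hQ]; simp only
        rw [hexp]
        exact sum_congr rfl fun d _ => by ring) (fun X => hIX X Y Z) X
    refine this.trans ?_
    exact sum_congr rfl fun d _ => by ring
  have e2 : ∀ X Y Z, Q X Y Z = ∑ d ∈ (s.filter fun d => 4 ∣ d 0) with 4 ∣ d 1,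
      k d * (X ^ d 0 * Y ^ d 1 * Z ^ d 2) := by
    intro X Y Z
    have := keep_fourth (s.filter fun d => 4 ∣ d 0) (fun d => k d * (X ^ d 0 * Z ^ d 2))
      (fun d => d 1) (fun Y => Q X Y Z)
      (fun Y => by
        rw [e1]
        exact sum_congr rfl fun d _ => by ring) (fun Y => hIY X Y Z) Y
    refine this.trans ?_
    exact sum_congr rfl fun d _ => by ring
  have e3 : ∀ X Y Z, Q X Y Z = ∑ d ∈ ((s.filter fun d => 4 ∣ d 0).filter fun d => 4 ∣ d 1)
      with 4 ∣ d 2, k d * (X ^ d 0 * Y ^ d 1 * Z ^ d 2) := by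
    intro X Y Z
    have := keep_fourth ((s.filter fun d => 4 ∣ d 0).filter fun d => 4 ∣ d 1)
      (fun d => k d * (X ^ d 0 * Y ^ d 1))
      (fun d => d 2) (fun Z => Q X Y Z)
      (fun Z => by
        rw [e2]
        exact sum_congr rfl fun d _ => by ring) (fun Z => hIZ X Y Z) Z
    refine this.trans ?_
    exact sum_congr rfl fun d _ => by ring
  set s' := ((s.filter fun d => 4 ∣ d 0).filter fun d => 4 ∣ d 1).filter fun d => 4 ∣ d 2 with hs'
  have hmem : ∀ d ∈ s', d 0 = 4 * (d 0 / 4) ∧ d 1 = 4 * (d 1 / 4) ∧ d 2 = 4 * (d 2 / 4) ∧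
      d 1 / 4 + d 0 / 4 + d 2 / 4 = 2 * h := by
    intro d hd
    simp only [hs', mem_filter] at hd
    have := hsum d hd.1.1.1
    omega
  let f : ℂ → ℂ → ℂ := fun y u => ∑ d ∈ s',
    k d * (0 * u + 1 * y) ^ (d 1 / 4) * (1 * u + (1 / 2) * y) ^ (d 0 / 4)
      * (1 * u + (-1 / 2) * y) ^ (d 2 / 4)
  have hform : IsForm (2 * h) f := by
    refine isForm_sum s' _ _ fun d hd => ?_
    have h1 := isForm_mul_lin_pow (isForm_mul_lin_pow (isForm_mul_lin_pow (isForm_const (k d))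
      0 1 (d 1 / 4)) 1 (1 / 2) (d 0 / 4)) 1 (-1 / 2) (d 2 / 4)
    rw [zero_add, (hmem d hd).2.2.2] at h1
    exact h1
  have hfQ : ∀ X Y Z y u : ℂ, X ^ 4 = u + y / 2 → Y ^ 4 = y → Z ^ 4 = u - y / 2 →
      f y u = Q X Y Z := by
    intro X Y Z y u hX hY hZ
    rw [e3]
    refine sum_congr rfl fun d hd => ?_
    obtain ⟨h0, h1, h2, -⟩ := hmem d hd
    have p0 : X ^ d 0 = (1 * u + (1 / 2) * y) ^ (d 0 / 4) := by
      conv_lhs => rw [h0]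
      rw [pow_mul, hX]; congr 1; ring
    have p1 : Y ^ d 1 = (0 * u + 1 * y) ^ (d 1 / 4) := by
      conv_lhs => rw [h1]
      rw [pow_mul, hY]; congr 1; ring
    have p2 : Z ^ d 2 = (1 * u + (-1 / 2) * y) ^ (d 2 / 4) := by
      conv_lhs => rw [h2]
      rw [pow_mul, hZ]; congr 1; ring
    rw [p0, p1, p2]; ring
  have hroot : ∀ x : ℂ, ∃ r : ℂ, r ^ 4 = x := fun x =>
    IsAlgClosed.exists_pow_nat_eq x (by norm_num)
  have hev : ∀ y u, f (-y) u = f y u := by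
    intro y u
    obtain ⟨X, hX⟩ := hroot (u + y / 2)
    obtain ⟨Y, hY⟩ := hroot y
    obtain ⟨Z, hZ⟩ := hroot (u - y / 2)
    rw [hfQ X Y Z y u hX hY hZ, ← hTw ζ hζ]
    apply hfQ
    · rw [hZ]; ring
    · rw [mul_pow, hζ, hY]; ring
    · rw [hX]; ring
  have hsw : ∀ y u, f y u = f (u - y / 2) (u / 2 + 3 * y / 4) := by
    intro y u
    obtain ⟨X, hX⟩ := hroot (u + y / 2)
    obtain ⟨Y, hY⟩ := hroot y
    obtain ⟨Z, hZ⟩ := hroot (u - y / 2)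
    rw [hfQ X Y Z y u hX hY hZ, ← hS]
    symm
    apply hfQ
    · rw [hX]; ring
    · rw [hZ]
    · rw [hY]; ring
  obtain ⟨e, he⟩ := isForm_even hform hev
  refine ⟨e, fun y u => ?_, fun X Y Z y u hX hY hZ => ?_⟩
  · rw [← he, ← he]; exact hsw y u
  · rw [← he]; exact hfQ X Y Z y u hX hY hZ

/-- The restricted enumerator near the cusp. -/
lemma swe_cusp {n : ℕ} (D : Finset (Fin n → ZMod 4)) (h0 : (0 : Fin n → ZMod 4) ∈ D)
    (h8 : ∀ v ∈ D, 8 ∣ euclWt v) (hmin : ∀ v ∈ D, v ≠ 0 → 32 ≤ euclWt v) :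
    ∃ G : Polynomial ℂ, ∀ b c t : ℂ, c ^ 2 = t → b ^ 4 = c * (1 + t) / 2 →
      swe D 1 b c = 1 + t ^ 4 * G.eval t := by
  let n1 : (Fin n → ZMod 4) → ℕ := fun v => ∑ i, if v i = 0 then 0 else if v i = 2 then 0 else 1
  let n2 : (Fin n → ZMod 4) → ℕ := fun v => ∑ i, if v i = 0 then 0 else if v i = 2 then 1 else 0
  have hw : ∀ v, euclWt v = n1 v + 4 * n2 v := by
    intro v
    simp only [euclWt, n1, n2, mul_sum, ← sum_add_distrib]
    refine sum_congr rfl fun i _ => ?_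
    split_ifs <;> rfl
  have hp : ∀ (b c : ℂ) v, ∏ i, locWt 1 b c (v i) = b ^ n1 v * c ^ n2 v := by
    intro b c v
    simp only [n1, n2, ← prod_pow_eq_pow_sum, ← prod_mul_distrib]
    refine prod_congr rfl fun i _ => ?_
    unfold locWt
    split_ifs <;> simp
  refine ⟨∑ v ∈ D.erase 0, Polynomial.X ^ (euclWt v / 8 - 4)
    * (Polynomial.C (1 / 2) * (1 + Polynomial.X)) ^ (n1 v / 4), fun b c t hc hb => ?_⟩
  unfold swe
  rw [← add_sum_erase D _ h0, Polynomial.eval_finsetSum, mul_sum]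
  congr 1
  · simp [locWt]
  · refine sum_congr rfl fun v hv => ?_
    have hvD := (mem_erase.1 hv).2
    have hv0 := (mem_erase.1 hv).1
    have a1 := h8 v hvD
    have a2 := hmin v hvD hv0
    have a3 := hw v
    rw [hp]
    simp only [Polynomial.eval_add, Polynomial.eval_mul, Polynomial.eval_C, Polynomial.eval_X,
      Polynomial.eval_pow, Polynomial.eval_one]
    obtain ⟨k, J, hk, hJ, h2⟩ : ∃ k J, n1 v = 4 * k ∧ euclWt v = 8 * (4 + J) ∧
        k + n2 v = 2 * (4 + J) := ⟨n1 v / 4, euclWt v / 8 - 4, by omega, by omega, by omega⟩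
    rw [show euclWt v / 8 - 4 = J by omega, show n1 v / 4 = k by omega, hk, pow_mul, hb]
    have : c ^ k * c ^ n2 v = t ^ 4 * t ^ J := by
      rw [← pow_add, h2, pow_mul, hc, pow_add]
    have h3 : (c * (1 + t) / 2) ^ k = c ^ k * (1 / 2 * (1 + t)) ^ k := by
      rw [← mul_pow]; congr 1; ring
    rw [h3]
    linear_combination (1 / 2 * (1 + t)) ^ k * this

/-- The bound on the minimum Euclidean weight of Type II codes in the three lengths. -/
lemma typeII_bound {n : ℕ} (hn : n = 48 ∨ n = 56 ∨ n = 64) (D : Set (Fin n → ZMod 4))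
    (hD : IsTypeIIZ4 D) : ∃ v ∈ D, v ≠ 0 ∧ euclWt v ≤ 24 := by
  classical
  by_contra hcon
  push Not at hcon
  have hmin : ∀ v ∈ D, v ≠ 0 → 32 ≤ euclWt v := by
    intro v hv hv0
    have h1 := hcon v hv hv0
    have h2 := hD.2 v hv
    omega
  have h0 : (0 : Fin n → ZMod 4) ∈ D := by
    rw [hD.1]; intro c _; simp [z4Inner]
  obtain ⟨E, rfl⟩ : ∃ E : Finset (Fin n → ZMod 4), D = (E : Set (Fin n → ZMod 4)) :=
    ⟨D.toFinite.toFinset, by simp⟩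
  obtain ⟨G, hG⟩ := swe_cusp E (by simpa using h0) (fun v hv => hD.2 v (by simpa using hv))
    (fun v hv => hmin v (by simpa using hv))
  have main : ∀ h : ℕ, n = 8 * h → ∃ e : ℕ → ℂ,
      (∀ y u : ℂ, ∑ j ∈ range (h + 1), e j * y ^ (2 * j) * u ^ (2 * h - 2 * j)
        = ∑ j ∈ range (h + 1), e j * (u - y / 2) ^ (2 * j)
          * (u / 2 + 3 * y / 4) ^ (2 * h - 2 * j)) ∧
      ∀ t : ℂ, ∑ j ∈ range (h + 1), e j * (64 * t * (1 + t) ^ 2) ^ j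
        * (1 + 6 * t + t ^ 2) ^ (2 * h - 2 * j) = 1 + t ^ 4 * G.eval t := by
    intro h hh
    subst hh
    obtain ⟨e, he1, he2⟩ := exists_form E hD
    refine ⟨e, he1, fun t => ?_⟩
    obtain ⟨c, hc⟩ : ∃ c : ℂ, c ^ 2 = t := IsAlgClosed.exists_pow_nat_eq t (by norm_num)
    obtain ⟨Y, hY⟩ : ∃ Y : ℂ, Y ^ 4 = 8 * c * (1 + t) :=
      IsAlgClosed.exists_pow_nat_eq _ (by norm_num)
    have h1 := he2 (1 + c) Y (1 - c) (8 * c * (1 + t)) (1 + 6 * t + t ^ 2)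
      (by rw [← hc]; ring) hY (by rw [← hc]; ring)
    rw [show (1 + c + (1 - c)) / 2 = 1 by ring, show (1 + c - (1 - c)) / 2 = c by ring,
      hG (Y / 2) c t hc (by rw [div_pow, hY]; ring)] at h1
    rw [← h1]
    refine sum_congr rfl fun j _ => ?_
    rw [pow_mul (8 * c * (1 + t)) 2 j, show (8 * c * (1 + t)) ^ 2 = 64 * t * (1 + t) ^ 2 by
      rw [← hc]; ring]
  rcases hn with hn | hn | hn
  · obtain ⟨e, h1, h2⟩ := main 6 hn
    exact no_form_12 e G h1 h2
  · obtain ⟨e, h1, h2⟩ := main 7 hn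
    exact no_form_14 e G h1 h2
  · obtain ⟨e, h1, h2⟩ := main 8 hn
    exact no_form_16 e G h1 h2

/-- Doubling as a homomorphism from integers mod 4 to integers mod 8. -/
def dbl48 : ZMod 4 →+ ZMod 8 :=
  AddMonoidHom.mk' (fun z => ((2 * z.val : ℕ) : ZMod 8)) (by decide)

lemma euclWt_add {n : ℕ} (x y : Fin n → ZMod 4) :
    (euclWt (x + y) : ZMod 8) = euclWt x + euclWt y + dbl48 (z4Inner x y) := by
  have key : ∀ a b : ZMod 4,
      (((if a + b = 0 then 0 else if a + b = 2 then 4 else 1 : ℕ)) : ZMod 8)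
      = ((if a = 0 then 0 else if a = 2 then 4 else 1 : ℕ) : ZMod 8)
        + ((if b = 0 then 0 else if b = 2 then 4 else 1 : ℕ) : ZMod 8) + dbl48 (a * b) := by
    decide
  unfold euclWt z4Inner
  rw [map_sum, Nat.cast_sum, Nat.cast_sum, Nat.cast_sum, ← sum_add_distrib, ← sum_add_distrib]
  exact sum_congr rfl fun i _ => key (x i) (y i)

lemma euclWt_even {n : ℕ} (tu : Fin n → ZMod 4) (hev : IsEvenVec tu) :
    euclWt tu = 4 * (Sset tu 2).card := by
  unfold euclWt Sset
  rw [card_filter, mul_sum]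
  refine sum_congr rfl fun i _ => ?_
  rcases hev i with h | h <;> rw [h] <;> decide

lemma euclWt_pos {n : ℕ} (x : Fin n → ZMod 4) (hx : x ≠ 0) : 0 < euclWt x := by
  obtain ⟨i, hi⟩ := Function.ne_iff.1 hx
  have hi' : x i ≠ 0 := hi
  refine sum_pos' (fun _ _ => Nat.zero_le _) ⟨i, mem_univ i, ?_⟩
  rw [if_neg hi']
  split_ifs <;> norm_num

lemma doubled_typeII {n : ℕ} (C : Submodule (ZMod 4) (Fin n → ZMod 4))
    (hC : IsTypeIIZ4 (C : Set (Fin n → ZMod 4)))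
    (tu : Fin n → ZMod 4) (hev : IsEvenVec tu) (htu : tu ∉ C)
    (h2 : Even (Sset tu 2).card) :
    IsTypeIIZ4 (doubled (C : Set (Fin n → ZMod 4)) tu) := by
  obtain ⟨hsd, hwt⟩ := hC
  have hmem : ∀ y, y ∈ C ↔ ∀ c ∈ C, z4Inner y c = 0 := by
    intro y
    have : y ∈ (C : Set (Fin n → ZMod 4)) ↔ y ∈ z4Dual (C : Set (Fin n → ZMod 4)) := by
      rw [← hsd]
    simpa [z4Dual] using this
  have htt : z4Inner tu tu = 0 := by
    refine sum_eq_zero fun i _ => ?_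
    rcases hev i with h | h <;> rw [h] <;> decide
  have htwo : ∀ v, z4Inner tu v = 0 ∨ z4Inner tu v = 2 := by
    intro v
    have h : 2 * z4Inner tu v = 0 := by
      rw [← z4Inner_smul_left]
      refine sum_eq_zero fun i _ => ?_
      have : (2 • tu : Fin n → ZMod 4) i = 0 := by
        rw [Pi.smul_apply]
        rcases hev i with h | h <;> rw [h] <;> decide
      have h' : ((2 : ZMod 4) • tu) i = 0 := by
        rw [Pi.smul_apply]
        rcases hev i with h | h <;> rw [h] <;> decide
      rw [h', zero_mul]
    revert h
    generalize z4Inner tu v = z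
    revert z
    decide
  have h8t : (euclWt tu : ZMod 8) = 0 := by
    rw [euclWt_even tu hev]
    obtain ⟨k, hk⟩ := h2
    rw [hk, ZMod.natCast_eq_zero_iff]
    exact ⟨k, by ring⟩
  constructor
  · apply Set.Subset.antisymm
    · rintro _ ⟨v, hv, hvt, a, rfl⟩ _ ⟨w, hw, hwt, b, rfl⟩
      rw [z4Inner_add_left, z4Inner_add_right, z4Inner_add_right, z4Inner_smul_left,
        z4Inner_smul_left, z4Inner_smul_right, z4Inner_smul_right, z4Inner_comm v tu, hvt, hwt,
        htt, (hmem v).1 hv w hw]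
      simp
    · intro x hx
      have hxt : z4Inner x tu = 0 := by
        apply hx
        exact ⟨0, C.zero_mem, by simp [z4Inner], 1, by simp⟩
      have hx0 : ∀ v ∈ C, z4Inner tu v = 0 → z4Inner x v = 0 := by
        intro v hv hvt
        apply hx
        exact ⟨v, hv, hvt, 0, by simp⟩
      obtain ⟨v1, hv1, hv1t⟩ : ∃ v ∈ C, z4Inner tu v ≠ 0 := by
        by_contra hcon
        push Not at hcon
        exact htu ((hmem tu).2 hcon)
      have hv12 : z4Inner tu v1 = 2 := (htwo v1).resolve_left hv1t
      obtain ⟨a, ha⟩ : ∃ a : ZMod 4, z4Inner x v1 = a * 2 := by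
        have h := hx0 ((2 : ZMod 4) • v1) (C.smul_mem _ hv1) (by
          rw [z4Inner_smul_right, hv12]; decide)
        rw [z4Inner_smul_right] at h
        revert h
        generalize z4Inner x v1 = z
        revert z
        decide
      have hin : x + (-a) • tu ∈ C := by
        rw [hmem]
        intro v hv
        rw [z4Inner_add_left, z4Inner_smul_left]
        rcases htwo v with h | h
        · rw [h, hx0 v hv h]; simp
        · have h3 := hx0 (v + (-1 : ZMod 4) • v1) (C.add_mem hv (C.smul_mem _ hv1)) (by
            rw [z4Inner_add_right, z4Inner_smul_right, h, hv12]; decide)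
          rw [z4Inner_add_right, z4Inner_smul_right, ha] at h3
          rw [h]
          linear_combination h3
      refine ⟨x + (-a) • tu, hin, ?_, a, ?_⟩
      · rw [z4Inner_add_right, z4Inner_smul_right, htt, z4Inner_comm, hxt]; simp
      · rw [add_assoc, ← add_smul]; simp
  · rintro _ ⟨v, hv, hvt, a, rfl⟩
    have h8v : (euclWt v : ZMod 8) = 0 := (ZMod.natCast_eq_zero_iff _ _).2 (hwt v hv)
    rw [← ZMod.natCast_eq_zero_iff]
    have hat : a • tu = 0 ∨ a • tu = tu := by
      have hp : (a = 0 ∨ a = 2) ∨ (a = 1 ∨ a = 3) := by revert a; decide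
      rcases hp with hp | hp
      · left
        funext i
        rw [Pi.smul_apply, Pi.zero_apply]
        rcases hp with rfl | rfl <;> rcases hev i with h | h <;> rw [h] <;> decide
      · right
        funext i
        rw [Pi.smul_apply]
        rcases hp with rfl | rfl <;> rcases hev i with h | h <;> rw [h] <;> decide
    rcases hat with h | h
    · rw [h, add_zero, h8v]
    · rw [h, euclWt_add, h8v, h8t, z4Inner_comm, hvt]; simp

theorem stmt6 {n : ℕ} (hn : n ∈ ({48, 56, 64} : Set ℕ))
    (C : Submodule (ZMod 4) (Fin n → ZMod 4))
    (hC : IsExtremalTypeIIZ4 n (C : Set (Fin n → ZMod 4)))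
    (tu : Fin n → ZMod 4) (hev : IsEvenVec tu) (htu : tu ∉ C)
    (h2 : Even (Sset tu 2).card)
    (hne : ¬ IsExtremalTypeIIZ4 n (doubled (C : Set (Fin n → ZMod 4)) tu)) :
    ∃ v ∈ C, z4Inner tu v = 0 ∧ (euclWt (v + tu) = 8 ∨ euclWt (v + tu) = 16) := by
  have h24 : 8 * (n / 24) + 8 = 24 := by
    rcases hn with rfl | rfl | rfl <;> norm_num
  have hn' : n = 48 ∨ n = 56 ∨ n = 64 := by simpa using hn
  obtain ⟨hCII, hCmin⟩ := hC
  rw [h24] at hCmin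
  have hCge : ∀ v ∈ C, v ≠ 0 → 24 ≤ euclWt v := by
    intro v hv hv0
    rw [← hCmin]
    exact Nat.sInf_le ⟨v, ⟨hv, hv0⟩, rfl⟩
  have hD := doubled_typeII C hCII tu hev htu h2
  by_contra hcon
  push Not at hcon
  have hge : ∀ w ∈ doubled (C : Set (Fin n → ZMod 4)) tu, w ≠ 0 → 24 ≤ euclWt w := by
    intro w hw hw0
    have h8 := hD.2 w hw
    have hpos := euclWt_pos w hw0
    obtain ⟨v, hv, hvt, a, rfl⟩ := hw
    have hat : a • tu = 0 ∨ a • tu = tu := by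
      have hp : (a = 0 ∨ a = 2) ∨ (a = 1 ∨ a = 3) := by
        clear hw0 h8 hpos
        revert a; decide
      rcases hp with hp | hp
      · left
        funext i
        rw [Pi.smul_apply, Pi.zero_apply]
        rcases hp with rfl | rfl <;> rcases hev i with h | h <;> rw [h] <;> decide
      · right
        funext i
        rw [Pi.smul_apply]
        rcases hp with rfl | rfl <;> rcases hev i with h | h <;> rw [h] <;> decide
    rcases hat with h | h
    · rw [h, add_zero] at hw0 ⊢
      exact hCge v hv hw0
    · rw [h] at h8 hpos ⊢
      have := hcon v hv hvt
      omega
  obtain ⟨w, hw, hw0, hw24⟩ := typeII_bound hn' _ hD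
  refine hne ⟨hD, ?_⟩
  rw [h24]
  have hwe : euclWt w = 24 := le_antisymm hw24 (hge w hw hw0)
  apply le_antisymm
  · exact Nat.sInf_le ⟨w, ⟨hw, hw0⟩, hwe⟩
  · refine le_csInf ⟨_, w, ⟨hw, hw0⟩, rfl⟩ ?_
    rintro _ ⟨x, ⟨hx, hx0⟩, rfl⟩
    exact hge x hx hx0
end
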